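/- arXiv:1908.10157 — 4 statements merged into one kernel-verified Lean document; each statement's English description precedes it below -/
import Mathlib

section
/- Let (V, E, s, t) and (V, E', s', t') be two quivers without self-loops having the same underlying graph Γ, i.e., there is a bijection φ : E → E' such that for every e ∈ E the unordered pair {s'(φ(e)), t'(φ(e))} equals {s(e), t(e)}. Then for every finite field F_q and every dimension vector α ∈ Q_+, the number of isomorphism classes of absolutely indecomposable representations over F_q of dimension vector α is the same for the two quivers: m_{Ω,α}(q) = m_{Ω',α}(q). In other words, this number is independent of the orientation of the edges of Γ. -/
open scoped TensorProduct

noncomputable section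
/-- A representation `(M, f)` of the quiver `(V, E, s, t)` is indecomposable:
`⊕ M_v ≠ 0`, and for any family of internal direct sum decompositions
`M_v = W_v ⊕ W'_v` compatible with all the maps `f_e`, one of the two families is zero. -/
def IsIndecRep (F : Type) [Field F] {V E : Type} (s t : E → V)
    (M : V → Type) [∀ v, AddCommGroup (M v)] [∀ v, Module F (M v)]
    (f : ∀ e, M (s e) →ₗ[F] M (t e)) : Prop :=
  (∃ v, ∃ x : M v, x ≠ 0) ∧
  ∀ W W' : ∀ v, Submodule F (M v),
    (∀ v, IsCompl (W v) (W' v)) →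
    (∀ e, (W (s e)).map (f e) ≤ W (t e)) →
    (∀ e, (W' (s e)).map (f e) ≤ W' (t e)) →
    (∀ v, W v = ⊥) ∨ (∀ v, W' v = ⊥)

/-- A representation is absolutely indecomposable if its base change to the algebraic
closure of `F` is indecomposable. -/
def IsAbsIndecRep (F : Type) [Field F] {V E : Type} (s t : E → V)
    (M : V → Type) [∀ v, AddCommGroup (M v)] [∀ v, Module F (M v)]
    (f : ∀ e, M (s e) →ₗ[F] M (t e)) : Prop :=
  IsIndecRep (AlgebraicClosure F) s t (fun v => AlgebraicClosure F ⊗[F] M v)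
    (fun e => LinearMap.baseChange (AlgebraicClosure F) (f e))

/-- A representation of the quiver `(V, E, s, t)` of dimension vector `α` on the
coordinate spaces `F^{α v}`: a linear map `F^{α (s e)} → F^{α (t e)}` for every edge. -/
abbrev CoordRep (F : Type) [Field F] {V E : Type} (s t : E → V) (α : V → ℕ) : Type :=
  ∀ e : E, (Fin (α (s e)) → F) →ₗ[F] (Fin (α (t e)) → F)

/-- Isomorphism of two representations of dimension vector `α`. -/
def RepIso (F : Type) [Field F] {V E : Type} (s t : E → V) (α : V → ℕ)
    (π π' : CoordRep F s t α) : Prop :=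
  ∃ g : ∀ v, (Fin (α v) → F) ≃ₗ[F] (Fin (α v) → F),
    ∀ e, (g (t e)).toLinearMap ∘ₗ π e = π' e ∘ₗ (g (s e)).toLinearMap

/-- The number of isomorphism classes of absolutely indecomposable representations of
the quiver `(V, E, s, t)` over `F` with dimension vector `α`. -/
noncomputable def numAbsIndec (F : Type) [Field F] {V E : Type} (s t : E → V)
    (α : V → ℕ) : ℕ :=
  Nat.card (Quot fun π π' :
      {π : CoordRep F s t α // IsAbsIndecRep F s t (fun v => Fin (α v) → F) π} =>
    RepIso F s t α π.1 π'.1)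
namespace KacProof
open CategoryTheory Polynomial

theorem exists_pow_idem {R : Type*} [Monoid R] [Finite R] (a : R) :
    ∃ m, 0 < m ∧ a ^ m * a ^ m = a ^ m := by
  obtain ⟨i, j, hij, h⟩ := Finite.exists_ne_map_eq_of_infinite (fun n : ℕ => a ^ n)
  wlog hlt : i < j generalizing i j with H
  · exact H j i hij.symm h.symm (by omega)
  have step : ∀ n, i ≤ n → a ^ (n + (j - i)) = a ^ n := by
    intro n hn
    obtain ⟨k, rfl⟩ := Nat.exists_eq_add_of_le hn
    rw [show i + k + (j - i) = j + k by omega, pow_add, ← h, ← pow_add]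
  have step2 : ∀ k n, i ≤ n → a ^ (n + k * (j - i)) = a ^ n := by
    intro k
    induction k with
    | zero => simp
    | succ k ih =>
      intro n hn
      rw [show n + (k + 1) * (j - i) = (n + k * (j - i)) + (j - i) by ring, step _ (by omega),
        ih n hn]
  refine ⟨(i + 1) * (j - i), Nat.mul_pos (by omega) (by omega), ?_⟩
  rw [← pow_add]
  apply step2
  calc i ≤ (i + 1) * 1 := by omega
    _ ≤ _ := Nat.mul_le_mul_left _ (by omega)

theorem nilp_or_unit {R : Type*} [Ring R] [Finite R]
    (h : ∀ e : R, e * e = e → e = 0 ∨ e = 1) (x : R) : IsNilpotent x ∨ IsUnit x := by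
  obtain ⟨m, hm, he⟩ := exists_pow_idem x
  rcases h _ he with h0 | h1
  · exact Or.inl ⟨m, h0⟩
  · exact Or.inr (IsUnit.of_pow_eq_one h1 (by omega))

theorem exists_rho (F Ω : Type) [Field F] [Field Ω] [Algebra F Ω] [IsAlgClosed Ω]
    (R : Type) [Ring R] [Algebra F R] [Finite R] [Finite F] [Nontrivial R]
    (h : ∀ e : R, e * e = e → e = 0 ∨ e = 1) :
    ∃ ρ : R →ₐ[F] Ω, ∀ x, ρ x = 0 ↔ IsNilpotent x := by
  have nu := nilp_or_unit h
  have hnu : ∀ x : R, IsNilpotent x → ¬ IsUnit x := fun x hx hu => hx.not_isUnit hu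
  have hleft : ∀ x y : R, IsNilpotent y → IsNilpotent (x * y) := by
    intro x y hy
    rcases nu (x * y) with h1 | h1
    · exact h1
    · exfalso
      obtain ⟨u, hu⟩ := h1
      have : (↑u⁻¹ * x) * y = 1 := by rw [mul_assoc, ← hu]; simp
      rcases nu y with h2 | h2
      · have h3 : y * (↑u⁻¹ * x) = 1 := mul_eq_one_comm.mp this
        exact hnu y hy ⟨⟨y, _, h3, this⟩, rfl⟩
      · exact hnu y hy h2
  have hright : ∀ x y : R, IsNilpotent x → IsNilpotent (x * y) := by
    intro x y hy
    rcases nu (x * y) with h1 | h1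
    · exact h1
    · exfalso
      obtain ⟨u, hu⟩ := h1
      have : x * (y * ↑u⁻¹) = 1 := by rw [← mul_assoc, ← hu]; simp
      have h3 : (y * ↑u⁻¹) * x = 1 := mul_eq_one_comm.mp this
      exact hnu x hy ⟨⟨x, _, this, h3⟩, rfl⟩
  let J : Ideal R :=
    { carrier := {x | IsNilpotent x}
      zero_mem' := IsNilpotent.zero
      add_mem' := by
        intro a b ha hb
        rcases nu (a + b) with h1 | h1
        · exact h1
        · exfalso
          obtain ⟨u, hu⟩ := h1
          have h2 : ↑u⁻¹ * a = 1 - ↑u⁻¹ * b := by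
            rw [eq_sub_iff_add_eq, ← mul_add, ← hu]; simp
          have h3 := (hleft (↑u⁻¹) b hb).isUnit_one_sub
          rw [← h2] at h3
          exact hnu _ (hleft _ _ ha) h3
      smul_mem' := fun c x hx => hleft c x hx }
  have memJ : ∀ x, x ∈ J ↔ IsNilpotent x := fun x => Iff.rfl
  have : J.IsTwoSided := ⟨fun {a} b ha => hright a b ha⟩
  have hJ : J ≠ ⊤ := by
    intro hJ
    have : (1 : R) ∈ J := by rw [hJ]; trivial
    exact hnu 1 this isUnit_one
  have : Nontrivial (R ⧸ J) := Ideal.Quotient.nontrivial_iff.mpr hJ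
  have : Finite (R ⧸ J) := Quotient.finite _
  have hunit : ∀ a : R ⧸ J, a ≠ 0 → IsUnit a := by
    intro a ha
    obtain ⟨x, rfl⟩ := Ideal.Quotient.mk_surjective a
    rcases nu x with h1 | h1
    · exact absurd (Ideal.Quotient.eq_zero_iff_mem.mpr h1) ha
    · exact h1.map _
  let dr : DivisionRing (R ⧸ J) := DivisionRing.ofIsUnitOrEqZero (fun a => by
    by_cases ha : a = 0
    · exact Or.inr ha
    · exact Or.inl (hunit a ha))
  let fd : Field (R ⧸ J) := @littleWedderburn (R ⧸ J) dr _
  have : Module.Finite F (R ⧸ J) := Module.Finite.of_finite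
  have : Algebra.IsAlgebraic F (R ⧸ J) := Algebra.IsAlgebraic.of_finite F _
  let g : (R ⧸ J) →ₐ[F] Ω := IsAlgClosed.lift
  refine ⟨g.comp (Ideal.Quotient.mkₐ F J), fun x => ?_⟩
  rw [← memJ, ← Ideal.Quotient.eq_zero_iff_mem]
  simp only [AlgHom.comp_apply]
  exact map_eq_zero_iff g g.injective

end KacProof

set_option linter.unusedSectionVars false
namespace KacProof
open CategoryTheory Polynomial

abbrev toE {C : Type} [Category.{0} C] {X : C} (f : X ⟶ X) : End X := f

def Indec {C : Type} [Category.{0} C] [Preadditive C] (N : C) : Prop :=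
  (1 : End N) ≠ 0 ∧ ∀ e : End N, e * e = e → e = 0 ∨ e = 1

/-- A direct sum decomposition of `M`. -/
structure Dec {C : Type} [Category.{0} C] [Preadditive C] (M : C) {X : Type} [Fintype X]
    (N : X → C) where
  inj : ∀ x, N x ⟶ M
  prj : ∀ x, M ⟶ N x
  self : ∀ x, inj x ≫ prj x = 𝟙 (N x)
  ne : ∀ x y, x ≠ y → inj x ≫ prj y = 0
  total : ∑ x, prj x ≫ inj x = 𝟙 M

/-- A system of pairwise non-isomorphic indecomposables with residue maps. -/
structure Sys (F Ω : Type) [Field F] [Field Ω] [Algebra F Ω] (C : Type) [Category.{0} C]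
    [Preadditive C] [Linear F C] where
  I : Type
  N : I → C
  indec : ∀ i, Indec (N i)
  eq_of_iso : ∀ i j, (N i ≅ N j) → i = j
  ρ : ∀ i, End (N i) →ₐ[F] Ω
  hρ : ∀ i x, ρ i x = 0 ↔ IsNilpotent x

section
variable {F Ω : Type} [Field F] [Field Ω] [Algebra F Ω] {C : Type} [Category.{0} C]
    [Preadditive C] [Linear F C] [hfin : ∀ X Y : C, Finite (X ⟶ Y)] (S : Sys F Ω C)

theorem end_finite (X : C) : Finite (End X) := hfin X X

include hfin in
theorem Sys.nilp_of_ne {i j : S.I} (h : i ≠ j) (f : S.N i ⟶ S.N j) (g : S.N j ⟶ S.N i) :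
    IsNilpotent (toE (f ≫ g)) := by
  have := end_finite (S.N i)
  rcases nilp_or_unit (S.indec i).2 (toE (f ≫ g)) with h1 | h1
  · exact h1
  exfalso
  obtain ⟨u, hu⟩ := h1
  obtain ⟨v, hv⟩ : ∃ v : S.N i ⟶ S.N i, f ≫ g ≫ v = 𝟙 _ := by
    refine ⟨(↑u⁻¹ : End (S.N i)), ?_⟩
    have h2 : (↑u⁻¹ : End (S.N i)) * (↑u : End (S.N i)) = 1 := by simp
    rw [hu, End.mul_def] at h2
    refine Eq.trans ?_ h2
    simp [toE]
  have hid : toE ((g ≫ v) ≫ f) * toE ((g ≫ v) ≫ f) = toE ((g ≫ v) ≫ f) := by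
    rw [End.mul_def]
    simp only [Category.assoc]
    rw [reassoc_of% hv]
  rcases (S.indec j).2 _ hid with h3 | h3
  · apply (S.indec i).1
    have : (f ≫ g ≫ v) ≫ (f ≫ g ≫ v) = 𝟙 _ := by rw [hv]; simp
    have h4 : f ≫ ((g ≫ v) ≫ f) ≫ g ≫ v = 𝟙 _ := by simpa using this
    rw [show (g ≫ v) ≫ f = 0 from h3] at h4
    simp only [Limits.zero_comp, Limits.comp_zero] at h4
    exact h4.symm
  · exact h (S.eq_of_iso i j ⟨f, g ≫ v, hv, h3⟩)

open Classical in
def Sys.rr {i j : S.I} (f : S.N i ⟶ S.N j) : Ω :=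
  if h : i = j then S.ρ i (f ≫ eqToHom (by rw [h])) else 0

theorem Sys.rr_self {i : S.I} (f : S.N i ⟶ S.N i) : S.rr f = S.ρ i f := by
  simp [Sys.rr]

theorem Sys.rr_ne {i j : S.I} (h : i ≠ j) (f : S.N i ⟶ S.N j) : S.rr f = 0 := by
  simp [Sys.rr, h]

theorem Sys.rr_id (i : S.I) : S.rr (𝟙 (S.N i)) = 1 := by
  rw [S.rr_self]; exact map_one (S.ρ i)

theorem Sys.rr_add {i j : S.I} (f g : S.N i ⟶ S.N j) : S.rr (f + g) = S.rr f + S.rr g := by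
  by_cases h : i = j
  · subst h
    simp only [S.rr_self]
    exact map_add (S.ρ i) f g
  · simp [S.rr_ne h]

theorem Sys.rr_smul {i j : S.I} (a : F) (f : S.N i ⟶ S.N j) :
    S.rr (a • f) = algebraMap F Ω a * S.rr f := by
  by_cases h : i = j
  · subst h
    simp only [S.rr_self]
    rw [← Algebra.smul_def]
    exact map_smul (S.ρ i) a f
  · simp [S.rr_ne h]

def Sys.rrHom (i j : S.I) : (S.N i ⟶ S.N j) →+ Ω := AddMonoidHom.mk' S.rr S.rr_add

theorem Sys.rr_sum {i j : S.I} {X : Type} (s : Finset X) (f : X → (S.N i ⟶ S.N j)) :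
    S.rr (∑ x ∈ s, f x) = ∑ x ∈ s, S.rr (f x) := map_sum (S.rrHom i j) f s

theorem Sys.rr_zero {i j : S.I} : S.rr (0 : S.N i ⟶ S.N j) = 0 := map_zero (S.rrHom i j)

include hfin in
theorem Sys.rr_comp {i j k : S.I} (f : S.N i ⟶ S.N j) (g : S.N j ⟶ S.N k) :
    S.rr (f ≫ g) = S.rr g * S.rr f := by
  by_cases hij : i = j
  · subst hij
    by_cases hik : i = k
    · subst hik
      simp only [S.rr_self]
      exact map_mul (S.ρ i) (toE g) (toE f)
    · simp [S.rr_ne hik]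
  · rw [S.rr_ne hij f, mul_zero]
    by_cases hik : i = k
    · subst hik
      rw [S.rr_self, S.hρ]
      exact S.nilp_of_ne hij f g
    · simp [S.rr_ne hik]

variable {X Y Z : Type} [Fintype X] [Fintype Y] [Fintype Z]
  {c : X → S.I} {c' : Y → S.I} {c'' : Z → S.I} {M M' M'' : C}

def blk (D : Dec M (fun x => S.N (c x))) (D' : Dec M' (fun x => S.N (c' x))) (θ : M ⟶ M') :
    Matrix Y X Ω := fun y x => S.rr (D.inj x ≫ θ ≫ D'.prj y)

variable (D : Dec M (fun x => S.N (c x))) (D' : Dec M' (fun x => S.N (c' x)))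
  (D'' : Dec M'' (fun x => S.N (c'' x)))

include hfin in
theorem blk_comp (f : M ⟶ M') (g : M' ⟶ M'') :
    blk S D D'' (f ≫ g) = blk S D' D'' g * blk S D D' f := by
  ext z x
  simp only [blk, Matrix.mul_apply]
  have : D.inj x ≫ (f ≫ g) ≫ D''.prj z
      = ∑ y, (D.inj x ≫ f ≫ D'.prj y) ≫ (D'.inj y ≫ g ≫ D''.prj z) := by
    calc _ = (D.inj x ≫ f) ≫ 𝟙 M' ≫ g ≫ D''.prj z := by simp
      _ = _ := by rw [← D'.total]; simp [Preadditive.sum_comp, Preadditive.comp_sum]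
  rw [this, S.rr_sum]
  exact Finset.sum_congr rfl fun y _ => S.rr_comp _ _

theorem blk_id [DecidableEq X] : blk S D D (𝟙 M) = 1 := by
  ext x y
  simp only [blk, Category.id_comp, Matrix.one_apply]
  split_ifs with h
  · subst h; rw [D.self, S.rr_id]
  · rw [D.ne y x (Ne.symm h), S.rr_zero]

theorem blk_add (f g : M ⟶ M') : blk S D D' (f + g) = blk S D D' f + blk S D D' g := by
  ext x y
  simp [blk, S.rr_add]

theorem blk_smul (a : F) (f : M ⟶ M') : blk S D D' (a • f) = a • blk S D D' f := by
  ext x y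
  simp [blk, S.rr_smul, Algebra.smul_def]

def blkAlg [DecidableEq X] : End M →ₐ[F] Matrix X X Ω :=
  AlgHom.ofLinearMap
    { toFun := fun θ : End M => blk S D D θ
      map_add' := blk_add S D D
      map_smul' := blk_smul S D D }
    (blk_id S D) (fun f g => blk_comp S D D D g f)

theorem blkAlg_apply [DecidableEq X] (θ : End M) : blkAlg S D θ = blk S D D θ := rfl

include D D' in
/-- uniqueness of multiplicities -/
theorem Sys.card_fiber_eq [DecidableEq S.I] (e : M ≅ M') (i : S.I) :
    Fintype.card {x // c x = i} = Fintype.card {y // c' y = i} := by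
  classical
  have key : ∀ {X Y : Type} [Fintype X] [Fintype Y] {c : X → S.I} {c' : Y → S.I} {M M' : C}
      (D : Dec M (fun x => S.N (c x))) (D' : Dec M' (fun x => S.N (c' x))) (e : M ≅ M'),
      ((blk S D' D e.inv).submatrix (fun x : {x // c x = i} => x.1)
        (fun y : {y // c' y = i} => y.1)) *
      ((blk S D D' e.hom).submatrix (fun y : {y // c' y = i} => y.1)
        (fun x : {x // c x = i} => x.1)) = 1 := by
    intro X Y _ _ c c' M M' D D' e
    ext x x'
    have h1 : blk S D' D e.inv * blk S D D' e.hom = 1 := by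
      rw [← blk_comp, e.hom_inv_id, blk_id]
    have h2 := congrFun (congrFun h1 x.1) x'.1
    rw [Matrix.mul_apply] at h2 ⊢
    simp only [Matrix.submatrix_apply]
    have h3 : (1 : Matrix {x // c x = i} {x // c x = i} Ω) x x' = (1 : Matrix X X Ω) x.1 x'.1 := by
      simp [Matrix.one_apply, Subtype.ext_iff]
    rw [h3, ← h2]
    have h4 := Finset.sum_subtype (F := inferInstance) (p := fun y => c' y = i) (Finset.univ.filter (fun y => c' y = i)) (by simp)
      (fun y => blk S D' D e.inv x.1 y * blk S D D' e.hom y x'.1)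
    refine h4.symm.trans ?_
    apply Finset.sum_filter_of_ne
    intro y _ hy
    by_contra hne
    apply hy
    have : blk S D' D e.inv x.1 y = 0 := S.rr_ne (fun h => hne (h.trans x.2)) _
    rw [this, zero_mul]
  exact (Matrix.square_of_invertible _ _ (key D D' e) (key D' D e.symm))

end
end KacProof

set_option linter.unusedSectionVars false
namespace KacProof
open CategoryTheory Polynomial

theorem card_hom {G H : Type} [AddGroup G] [AddGroup H] (f : G →+ H) (P : H → Prop) :
    Nat.card {g // P (f g)} = Nat.card f.ker * Nat.card {h // h ∈ Set.range f ∧ P h} := by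
  rw [← Nat.card_prod]
  have hs : ∀ h : {h // h ∈ Set.range f ∧ P h}, ∃ g, f g = h.1 := fun h => h.2.1
  choose sec hsec using hs
  refine Nat.card_congr
    { toFun := fun g => (⟨g.1 - sec ⟨f g.1, ⟨g.1, rfl⟩, g.2⟩, by
        rw [AddMonoidHom.mem_ker, map_sub, hsec, sub_self]⟩, ⟨f g.1, ⟨g.1, rfl⟩, g.2⟩)
      invFun := fun kh => ⟨kh.1.1 + sec kh.2, by
        rw [map_add, (AddMonoidHom.mem_ker).1 kh.1.2, zero_add, hsec]; exact kh.2.2.2⟩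
      left_inv := fun g => by simp
      right_inv := ?_ }
  rintro ⟨⟨k, hk⟩, h⟩
  have hk' : f k = 0 := hk
  have : f (k + sec h) = h.1 := by rw [map_add, hk', zero_add, hsec]
  have h2 : (⟨f (k + sec h), ⟨_, rfl⟩, by rw [this]; exact h.2.2⟩ :
      {h // h ∈ Set.range f ∧ P h}) = h := Subtype.ext this
  simp only [Prod.mk.injEq, Subtype.mk.injEq]
  exact ⟨by rw [h2, add_sub_cancel_right], h2⟩

def wt {F : Type} [Field F] {C : Type} [Category.{0} C] [Preadditive C] [Linear F C]
    (p : F[X]) (M : C) : ℚ :=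
  (Nat.card {θ : End M // IsNilpotent (aeval θ p)} : ℚ) / Nat.card {θ : End M // IsUnit θ}

theorem ratio_hom {F : Type} [Field F] {R B : Type} [Ring R] [Ring B] [Algebra F R] [Algebra F B]
    [Finite R] (f : R →ₐ[F] B) (hf : ∀ x, f x = 0 → IsNilpotent x) (p : F[X]) :
    (Nat.card {θ : R // IsNilpotent (aeval θ p)} : ℚ) / Nat.card {θ : R // IsUnit θ} =
    (Nat.card {b : B // b ∈ Set.range f ∧ IsNilpotent (aeval b p)} : ℚ) /
      Nat.card {b : B // b ∈ Set.range f ∧ IsUnit b} := by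
  have hn : ∀ x : R, IsNilpotent x ↔ IsNilpotent (f x) := by
    intro x
    refine ⟨fun h => h.map f, ?_⟩
    rintro ⟨k, hk⟩
    rw [← map_pow] at hk
    obtain ⟨l, hl⟩ := hf _ hk
    exact ⟨k * l, by rw [pow_mul, hl]⟩
  have hu : ∀ x : R, IsUnit x ↔ IsUnit (f x) := by
    intro x
    refine ⟨fun h => h.map f, ?_⟩
    intro h
    obtain ⟨m, hm, he⟩ := exists_pow_idem x
    have h1 : IsUnit (f (x ^ m)) := by rw [map_pow]; exact h.pow m
    have h2 : f (x ^ m) = 1 := by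
      have : f (x ^ m) * f (x ^ m) = f (x ^ m) * 1 := by rw [← map_mul, he, mul_one]
      exact h1.mul_left_cancel this
    have h3 : IsNilpotent (1 - x ^ m) := hf _ (by rw [map_sub, h2, map_one, sub_self])
    have h4 := h3.isUnit_one_sub
    rw [sub_sub_cancel] at h4
    exact (isUnit_pow_iff (by omega)).1 h4
  have e1 : Nat.card {θ : R // IsNilpotent (aeval θ p)} = Nat.card f.toRingHom.toAddMonoidHom.ker *
      Nat.card {b : B // b ∈ Set.range f ∧ IsNilpotent (aeval b p)} := by
    refine Eq.trans ?_ (card_hom f.toRingHom.toAddMonoidHom (fun b => IsNilpotent (aeval b p)))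
    refine Nat.card_congr (Equiv.subtypeEquivRight fun x => ?_)
    rw [hn, ← aeval_algHom_apply]; rfl
  have e2 : Nat.card {θ : R // IsUnit θ} = Nat.card f.toRingHom.toAddMonoidHom.ker *
      Nat.card {b : B // b ∈ Set.range f ∧ IsUnit b} := by
    refine Eq.trans ?_ (card_hom f.toRingHom.toAddMonoidHom (fun b => IsUnit b))
    refine Nat.card_congr (Equiv.subtypeEquivRight fun x => ?_)
    rw [hu]; rfl
  rw [e1, e2]
  push_cast
  have : (Nat.card f.toRingHom.toAddMonoidHom.ker : ℚ) ≠ 0 := by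
    exact_mod_cast (Nat.card_pos (α := f.toRingHom.toAddMonoidHom.ker)).ne'
  exact mul_div_mul_left _ _ this

section
variable {F Ω : Type} [Field F] [Field Ω] [Algebra F Ω] {C : Type} [Category.{0} C]
    [Preadditive C] [Linear F C] [hfin : ∀ X Y : C, Finite (X ⟶ Y)] (S : Sys F Ω C)

def Sys.n (i : S.I) : ℕ := Nat.card (Set.range (S.ρ i))

theorem Sys.finrange (i : S.I) : Finite (Set.range (S.ρ i)) := by
  have := end_finite (S.N i)
  exact Set.finite_range _

theorem Sys.subfield (i : S.I) : ∃ L : Subfield Ω, (L : Set Ω) = Set.range (S.ρ i) := by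
  have := end_finite (S.N i)
  refine ⟨{ (S.ρ i).toRingHom.range with inv_mem' := ?_ }, ?_⟩
  · rintro _ ⟨x, rfl⟩
    rcases nilp_or_unit (S.indec i).2 x with h | h
    · refine ⟨0, ?_⟩
      have : S.ρ i x = 0 := (S.hρ i x).2 h
      simp [this]
    · obtain ⟨u, rfl⟩ := h
      refine ⟨(↑u⁻¹ : End (S.N i)), ?_⟩
      apply eq_inv_of_mul_eq_one_left
      have : S.ρ i (↑u⁻¹ * ↑u) = 1 := by rw [Units.inv_mul, map_one]
      rw [map_mul] at this
      exact this
  · ext z; simp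

theorem Sys.one_lt_n (i : S.I) : 1 < S.n i := by
  obtain ⟨L, hL⟩ := S.subfield i
  have := S.finrange i
  unfold Sys.n
  rw [← hL] at *
  exact Finite.one_lt_card (α := L)

theorem Sys.mem_range (i : S.I) (z : Ω) : z ∈ Set.range (S.ρ i) ↔ z ^ S.n i = z := by
  obtain ⟨L, hL⟩ := S.subfield i
  have hf := S.finrange i
  have h1 := S.one_lt_n i
  have hn : S.n i = Nat.card L := by unfold Sys.n; rw [← hL]; rfl
  have hfL : Finite L := by rw [← hL] at hf; exact hf
  have := Fintype.ofFinite L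
  have hsub : ∀ z ∈ L, z ^ S.n i = z := by
    intro z hz
    rw [hn, Nat.card_eq_fintype_card]
    exact congrArg Subtype.val (FiniteField.pow_card (⟨z, hz⟩ : L))
  rw [← hL]
  refine ⟨fun h => hsub z h, fun h => ?_⟩
  classical
  let P : Polynomial Ω := Polynomial.X ^ S.n i - Polynomial.X
  have hP : P ≠ 0 := FiniteField.X_pow_card_sub_X_ne_zero Ω h1
  have hdeg : P.natDegree = S.n i := FiniteField.X_pow_card_sub_X_natDegree_eq Ω h1
  let T : Finset Ω := Finset.univ.image (fun x : L => x.1)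
  have hT : T ⊆ P.roots.toFinset := by
    intro y hy
    obtain ⟨x, -, rfl⟩ := Finset.mem_image.1 hy
    rw [Multiset.mem_toFinset, mem_roots hP]
    simp [P, hsub x.1 x.2]
  have hc : P.roots.toFinset.card ≤ T.card := by
    rw [Finset.card_image_of_injective _ Subtype.val_injective, Finset.card_univ,
      ← Nat.card_eq_fintype_card, ← hn, ← hdeg]
    exact (Multiset.toFinset_card_le _).trans (card_roots' P)
  have heq := Finset.eq_of_subset_of_card_le hT hc
  have hz : z ∈ T := by
    rw [heq, Multiset.mem_toFinset, mem_roots hP]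
    simp [P, h]
  obtain ⟨x, -, rfl⟩ := Finset.mem_image.1 hz
  exact x.2

def omega (Ω : Type) [Field Ω] [Algebra F Ω] (p : F[X]) (n : ℕ) : ℚ :=
  (Nat.card {z : Ω // z ^ n = z ∧ aeval z p = 0} : ℚ) / Nat.card {z : Ω // z ^ n = z ∧ z ≠ 0}

theorem Sys.wt_N (i : S.I) (p : F[X]) : wt p (S.N i) = omega Ω p (S.n i) := by
  have := end_finite (S.N i)
  unfold wt omega
  rw [ratio_hom (S.ρ i) (fun x => (S.hρ i x).1)]
  simp only [isNilpotent_iff_eq_zero, isUnit_iff_ne_zero, S.mem_range]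

variable (hsum : ∀ (M : C) (e : End M), e * e = e → e ≠ 0 →
    ∃ (i : S.I) (a : S.N i ⟶ M) (b : M ⟶ S.N i), a ≫ b = 𝟙 _ ∧ e ≫ b = b)

variable {X : Type} [Fintype X] [DecidableEq X]
  {c : X → S.I} {M : C} (D : Dec M (fun x => S.N (c x)))

include hsum in
theorem ker_nilp (θ : End M) (h : blkAlg S D θ = 0) : IsNilpotent θ := by
  have := end_finite M
  obtain ⟨m, hm, he⟩ := exists_pow_idem θ
  by_cases h0 : θ ^ m = 0
  · exact ⟨m, h0⟩
  exfalso
  obtain ⟨i, a, b, hab, heb⟩ := hsum M _ he h0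
  have h1 : blk S D D (b ≫ a) = 0 := by
    rw [← heb, Category.assoc, blk_comp S D D D]
    have : blk S D D (θ ^ m) = 0 := by
      rw [← blkAlg_apply, map_pow, h, zero_pow (by omega)]
    rw [this, mul_zero]
  have h2 : (1 : Ω) = ∑ x, blk S D D (b ≫ a) x x := by
    rw [← S.rr_id i, ← hab]
    have : a ≫ b = ∑ x, (a ≫ D.prj x) ≫ (D.inj x ≫ b) := by
      calc a ≫ b = a ≫ 𝟙 M ≫ b := by simp
        _ = _ := by rw [← D.total]; simp [Preadditive.sum_comp, Preadditive.comp_sum]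
    rw [this, S.rr_sum]
    refine Finset.sum_congr rfl fun x _ => ?_
    rw [S.rr_comp, mul_comm, ← S.rr_comp, blk]
    simp
  rw [h1] at h2
  simp at h2

theorem Sys.rr_pow {i j : S.I} (f : S.N i ⟶ S.N j) : S.rr f ^ S.n j = S.rr f := by
  by_cases h : i = j
  · subst h
    rw [S.rr_self, ← S.mem_range]
    exact ⟨_, rfl⟩
  · rw [S.rr_ne h, zero_pow]
    have := S.one_lt_n j; omega

theorem range_blkAlg (A : Matrix X X Ω) : A ∈ Set.range (blkAlg S D) ↔
    ∀ x y, (c x ≠ c y → A x y = 0) ∧ A x y ^ S.n (c x) = A x y := by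
  constructor
  · rintro ⟨θ, rfl⟩ x y
    rw [blkAlg_apply]
    have h1 : c x ≠ c y → blk S D D θ x y = 0 := fun h => S.rr_ne h.symm _
    refine ⟨h1, ?_⟩
    exact S.rr_pow _
  · intro h
    have key : ∀ x y, ∃ f : S.N (c y) ⟶ S.N (c x), S.rr f = A x y := by
      intro x y
      by_cases hxy : c x = c y
      · obtain ⟨f, hf⟩ := (S.mem_range (c x) _).2 (h x y).2
        have : ∀ j, c x = j → ∃ f : S.N j ⟶ S.N (c x), S.rr f = A x y := by
          rintro j rfl
          exact ⟨f, by rw [S.rr_self]; exact hf⟩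
        exact this _ hxy
      · exact ⟨0, by rw [S.rr_zero, (h x y).1 hxy]⟩
    choose f hf using key
    refine ⟨toE (∑ x, ∑ y, D.prj y ≫ f x y ≫ D.inj x), ?_⟩
    rw [blkAlg_apply]
    ext x y
    rw [← hf x y]
    unfold blk
    congr 1
    unfold toE
    simp only [Preadditive.sum_comp, Preadditive.comp_sum, Category.assoc]
    rw [Finset.sum_eq_single x, Finset.sum_eq_single y]
    · rw [D.self]
      simp only [Category.comp_id]
      rw [← Category.assoc, D.self, Category.id_comp]
    · intro y' _ hy'
      rw [← Category.assoc, D.ne y y' hy'.symm, Limits.zero_comp]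
    · simp
    · intro x' _ hx'
      refine Finset.sum_eq_zero fun y' _ => ?_
      rw [D.ne x' x hx']
      simp
    · simp

include hsum D in
theorem wt_Dec (p : F[X]) : wt p M =
    (Nat.card {A : Matrix X X Ω // (∀ x y, (c x ≠ c y → A x y = 0) ∧ A x y ^ S.n (c x) = A x y)
        ∧ IsNilpotent (aeval A p)} : ℚ) /
    Nat.card {A : Matrix X X Ω // (∀ x y, (c x ≠ c y → A x y = 0) ∧ A x y ^ S.n (c x) = A x y)
        ∧ IsUnit A} := by
  have := end_finite M
  unfold wt
  rw [ratio_hom (blkAlg S D) (ker_nilp S hsum D)]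
  simp only [range_blkAlg]

end
end KacProof

set_option linter.all false
namespace KacProof
open CategoryTheory Polynomial

/-- combining decompositions -/
def Dec.bind {C : Type} [Category.{0} C] [Preadditive C] {M : C} {X : Type} [Fintype X]
    {N : X → C} (D : Dec M N) {Y : X → Type} [∀ x, Fintype (Y x)] {N' : ∀ x, Y x → C}
    (D' : ∀ x, Dec (N x) (N' x)) : Dec M (fun z : Σ x, Y x => N' z.1 z.2) where
  inj z := (D' z.1).inj z.2 ≫ D.inj z.1
  prj z := D.prj z.1 ≫ (D' z.1).prj z.2
  self z := by
    rw [Category.assoc, ← Category.assoc (D.inj z.1), D.self, Category.id_comp, (D' z.1).self]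
  ne := by
    rintro ⟨x, y⟩ ⟨x', y'⟩ h
    simp only [Category.assoc]
    by_cases hx : x = x'
    · subst hx
      rw [← Category.assoc (D.inj x), D.self, Category.id_comp, (D' x).ne]
      rintro rfl
      exact h rfl
    · rw [← Category.assoc (D.inj x), D.ne _ _ hx]; simp
  total := by
    rw [Fintype.sum_sigma, ← D.total]
    refine Finset.sum_congr rfl fun x _ => ?_
    calc _ = D.prj x ≫ (∑ y, (D' x).prj y ≫ (D' x).inj y) ≫ D.inj x := by
          simp [Preadditive.sum_comp, Preadditive.comp_sum]
      _ = _ := by rw [(D' x).total]; simp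

def Dec.single {C : Type} [Category.{0} C] [Preadditive C] {M : C} {N : C} (e : M ≅ N) :
    Dec M (fun _ : Unit => N) where
  inj _ := e.inv
  prj _ := e.hom
  self _ := e.inv_hom_id
  ne x y h := absurd rfl h
  total := by simp

def Dec.congrIso {C : Type} [Category.{0} C] [Preadditive C] {M M' : C} {X : Type} [Fintype X]
    {N : X → C} (D : Dec M N) (e : M ≅ M') : Dec M' N where
  inj x := D.inj x ≫ e.hom
  prj x := e.inv ≫ D.prj x
  self x := by simp [D.self]
  ne x y h := by simp [D.ne x y h]
  total := by
    calc _ = e.inv ≫ (∑ x, D.prj x ≫ D.inj x) ≫ e.hom := by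
          simp [Preadditive.sum_comp, Preadditive.comp_sum]
      _ = _ := by rw [D.total]; simp

def Dec.reindex {C : Type} [Category.{0} C] [Preadditive C] {M : C} {X Y : Type} [Fintype X]
    [Fintype Y] {N : X → C} (D : Dec M N) (e : Y ≃ X) : Dec M (fun y => N (e y)) where
  inj y := D.inj (e y)
  prj y := D.prj (e y)
  self y := D.self _
  ne x y h := D.ne _ _ (fun h' => h (e.injective h'))
  total := by rw [← D.total]; exact e.sum_comp (fun x => D.prj x ≫ D.inj x)

def Dec.ofIso {C : Type} [Category.{0} C] [Preadditive C] {M M' : C} {X : Type} [Fintype X]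
    {N : X → C} (D : Dec M N) (D' : Dec M' N) : M ≅ M' where
  hom := ∑ x, D.prj x ≫ D'.inj x
  inv := ∑ x, D'.prj x ≫ D.inj x
  hom_inv_id := by
    classical
    rw [← D.total]
    simp only [Preadditive.sum_comp, Preadditive.comp_sum, Category.assoc]
    refine Finset.sum_congr rfl fun x _ => ?_
    rw [Finset.sum_eq_single x]
    · rw [← Category.assoc (D'.inj x), D'.self, Category.id_comp]
    · intro y _ h
      rw [← Category.assoc (D'.inj y), D'.ne _ _ h]; simp
    · simp
  inv_hom_id := by
    classical
    rw [← D'.total]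
    simp only [Preadditive.sum_comp, Preadditive.comp_sum, Category.assoc]
    refine Finset.sum_congr rfl fun x _ => ?_
    rw [Finset.sum_eq_single x]
    · rw [← Category.assoc (D.inj x), D.self, Category.id_comp]
    · intro y _ h
      rw [← Category.assoc (D.inj y), D.ne _ _ h]; simp
    · simp

theorem Indec.ofIso {C : Type} [Category.{0} C] [Preadditive C] {M N : C} (h : Indec M)
    (i : M ≅ N) : Indec N := by
  constructor
  · intro h1
    apply h.1
    have : i.hom ≫ 𝟙 N ≫ i.inv = 𝟙 M := by simp
    rw [show 𝟙 N = 0 from h1] at this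
    simp only [Limits.zero_comp, Limits.comp_zero] at this
    exact this.symm
  · intro e he
    have he' : (show N ⟶ N from e) ≫ (show N ⟶ N from e) = e := he
    have h2 : toE (i.hom ≫ (show N ⟶ N from e) ≫ i.inv) * toE (i.hom ≫ e ≫ i.inv) =
        toE (i.hom ≫ e ≫ i.inv) := by
      rw [End.mul_def]
      unfold toE
      simp only [Category.assoc, Iso.inv_hom_id_assoc]
      rw [← Category.assoc (show N ⟶ N from e), he']
    have h3 : (show N ⟶ N from e) = i.inv ≫ (i.hom ≫ (show N ⟶ N from e) ≫ i.inv) ≫ i.hom := by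
      simp
    rcases h.2 _ h2 with h4 | h4
    · left
      refine h3.trans ?_
      rw [show (i.hom ≫ (show N ⟶ N from e) ≫ i.inv) = 0 from h4]; simp
    · right
      refine h3.trans ?_
      rw [show (i.hom ≫ (show N ⟶ N from e) ≫ i.inv) = 𝟙 M from h4]; simp

/-- coordinate representations as objects -/
structure QObj (F : Type) [Field F] {V E : Type} (s t : E → V) where
  α : V → ℕ
  f : CoordRep F s t α

section
variable {F : Type} [Field F] {V E : Type} {s t : E → V}

abbrev QObj.U (A : QObj F s t) (v : V) : Type := Fin (A.α v) → F

def homSub (A B : QObj F s t) : Submodule F (∀ v, A.U v →ₗ[F] B.U v) where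
  carrier := {g | ∀ e, g (t e) ∘ₗ A.f e = B.f e ∘ₗ g (s e)}
  zero_mem' e := by simp
  add_mem' {a b} ha hb e := by
    simp only [Pi.add_apply, LinearMap.add_comp, LinearMap.comp_add, ha e, hb e]
  smul_mem' r a ha e := by
    simp only [Pi.smul_apply, LinearMap.smul_comp, LinearMap.comp_smul, ha e]

instance : Category.{0} (QObj F s t) where
  Hom A B := homSub A B
  id A := ⟨fun v => LinearMap.id, fun e => by simp⟩
  comp {A B C} f g := ⟨fun v => g.1 v ∘ₗ f.1 v, fun e => by
    rw [LinearMap.comp_assoc, f.2 e, ← LinearMap.comp_assoc, g.2 e, LinearMap.comp_assoc]⟩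
  id_comp f := rfl
  comp_id f := rfl
  assoc f g h := rfl

theorem hom_ext {A B : QObj F s t} {f g : A ⟶ B} (h : ∀ v, f.1 v = g.1 v) : f = g :=
  Subtype.ext (funext h)

theorem comp_val {A B C : QObj F s t} (f : A ⟶ B) (g : B ⟶ C) (v : V) :
  (f ≫ g).1 v = g.1 v ∘ₗ f.1 v := rfl

theorem id_val (A : QObj F s t) (v : V) : (𝟙 A : A ⟶ A).1 v = LinearMap.id := rfl

instance : Preadditive (QObj F s t) where
  homGroup A B := inferInstanceAs (AddCommGroup (homSub A B))
  add_comp A B C f f' g := hom_ext fun v => LinearMap.comp_add _ _ _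
  comp_add A B C f g g' := hom_ext fun v => LinearMap.add_comp _ _ _

instance : Linear F (QObj F s t) where
  homModule A B := inferInstanceAs (Module F (homSub A B))
  smul_comp A B C r f g := hom_ext fun v => LinearMap.comp_smul _ _ _
  comp_smul A B C f r g := hom_ext fun v => LinearMap.smul_comp _ _ _

theorem zero_val {A B : QObj F s t} (v : V) : (0 : A ⟶ B).1 v = 0 := rfl
theorem add_val {A B : QObj F s t} (f g : A ⟶ B) (v : V) : (f + g).1 v = f.1 v + g.1 v := rfl
theorem smul_val {A B : QObj F s t} (a : F) (f : A ⟶ B) (v : V) : (a • f).1 v = a • f.1 v := rfl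
theorem sum_val {A B : QObj F s t} {X : Type} (S : Finset X) (f : X → (A ⟶ B)) (v : V) :
    (∑ x ∈ S, f x).1 v = ∑ x ∈ S, (f x).1 v := by
  let ev : (A ⟶ B) →+ (A.U v →ₗ[F] B.U v) :=
    { toFun := fun f => f.1 v, map_zero' := rfl, map_add' := fun _ _ => rfl }
  exact map_sum ev f S

instance hom_finite [Finite F] [Finite V] (A B : QObj F s t) : Finite (A ⟶ B) := by
  have : ∀ v, Finite (A.U v →ₗ[F] B.U v) := fun v => DFunLike.finite _
  exact inferInstanceAs (Finite (homSub A B))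

section ofMod
variable (M : V → Type) [∀ v, AddCommGroup (M v)] [∀ v, Module F (M v)]
  [∀ v, Module.Finite F (M v)] (f : ∀ e, M (s e) →ₗ[F] M (t e))

def coordEq (v : V) : M v ≃ₗ[F] (Fin (Module.finrank F (M v)) → F) :=
  (Module.finBasis F (M v)).equivFun

def ofMod : QObj F s t where
  α v := Module.finrank F (M v)
  f e := (coordEq M (t e)).toLinearMap ∘ₗ f e ∘ₗ (coordEq M (s e)).symm.toLinearMap

def toOfMod (A : QObj F s t) (g : ∀ v, A.U v →ₗ[F] M v)
    (hg : ∀ e, g (t e) ∘ₗ A.f e = f e ∘ₗ g (s e)) : A ⟶ ofMod M f :=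
  ⟨fun v => (coordEq M v).toLinearMap ∘ₗ g v, fun e => by
    apply LinearMap.ext
    intro x
    have := LinearMap.congr_fun (hg e) x
    change g (t e) (A.f e x) = f e (g (s e) x) at this
    change coordEq M (t e) (g (t e) (A.f e x)) =
      coordEq M (t e) (f e ((coordEq M (s e)).symm (coordEq M (s e) (g (s e) x))))
    rw [LinearEquiv.symm_apply_apply, this]⟩

def fromOfMod (A : QObj F s t) (g : ∀ v, M v →ₗ[F] A.U v)
    (hg : ∀ e, g (t e) ∘ₗ f e = A.f e ∘ₗ g (s e)) : ofMod M f ⟶ A :=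
  ⟨fun v => g v ∘ₗ (coordEq M v).symm.toLinearMap, fun e => by
    apply LinearMap.ext
    intro x
    have := LinearMap.congr_fun (hg e) ((coordEq M (s e)).symm x)
    change g (t e) (f e ((coordEq M (s e)).symm x)) =
      A.f e (g (s e) ((coordEq M (s e)).symm x)) at this
    change g (t e) ((coordEq M (t e)).symm (coordEq M (t e) (f e ((coordEq M (s e)).symm x)))) =
      A.f e (g (s e) ((coordEq M (s e)).symm x))
    rw [LinearEquiv.symm_apply_apply, this]⟩
end ofMod

theorem exists_sum {X : Type} [Fintype X] (N : X → QObj F s t) :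
    ∃ A : QObj F s t, Nonempty (Dec A N) := by
  classical
  let M : V → Type := fun v => ∀ x, (N x).U v
  let f : ∀ e, M (s e) →ₗ[F] M (t e) := fun e =>
    LinearMap.pi fun x => (N x).f e ∘ₗ LinearMap.proj x
  refine ⟨ofMod M f, ⟨
    { inj := fun x => toOfMod M f (N x) (fun v => LinearMap.single F (fun x => (N x).U v) x) ?_
      prj := fun x => fromOfMod M f (N x) (fun v => LinearMap.proj x) ?_
      self := ?_
      ne := ?_
      total := ?_ }⟩⟩
  · intro e
    apply LinearMap.ext
    intro a
    funext y
    change (Pi.single (M := fun x => (N x).U (t e)) x ((N x).f e a)) y =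
      (N y).f e ((Pi.single (M := fun x => (N x).U (s e)) x a) y)
    by_cases h : y = x
    · subst h; rw [Pi.single_eq_same, Pi.single_eq_same]
    · rw [Pi.single_eq_of_ne h, Pi.single_eq_of_ne h, map_zero]
  · intro e
    rfl
  · intro x
    refine hom_ext fun v => ?_
    apply LinearMap.ext
    intro a
    change ((coordEq M v).symm (coordEq M v (Pi.single (M := fun x => (N x).U v) x a))) x = a
    rw [LinearEquiv.symm_apply_apply, Pi.single_eq_same]
  · intro x y h
    refine hom_ext fun v => ?_
    apply LinearMap.ext
    intro a
    change ((coordEq M v).symm (coordEq M v (Pi.single (M := fun x => (N x).U v) x a))) y = 0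
    rw [LinearEquiv.symm_apply_apply, Pi.single_eq_of_ne (Ne.symm h)]
  · refine hom_ext fun v => ?_
    apply LinearMap.ext
    intro a
    rw [sum_val, LinearMap.sum_apply]
    change ∑ x, coordEq M v (Pi.single (M := fun x => (N x).U v) x ((coordEq M v).symm a x)) = a
    rw [← map_sum]
    have : ∀ b : M v, ∑ x, Pi.single (M := fun x => (N x).U v) x (b x) = b := by
      intro b
      exact Finset.univ_sum_single b
    exact (congrArg _ (this _)).trans ((coordEq M v).apply_symm_apply a)

theorem exists_split (A : QObj F s t) (e : A ⟶ A) (he : e ≫ e = e) :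
    ∃ (B : QObj F s t) (a : B ⟶ A) (b : A ⟶ B), a ≫ b = 𝟙 B ∧ b ≫ a = e := by
  let M : V → Type := fun v => LinearMap.range (e.1 v)
  have hc : ∀ k x, e.1 (t k) (A.f k x) = A.f k (e.1 (s k) x) := fun k x =>
    LinearMap.congr_fun (e.2 k) x
  have hi : ∀ v x, e.1 v (e.1 v x) = e.1 v x := fun v x =>
    LinearMap.congr_fun (congrArg (fun g : A ⟶ A => g.1 v) he) x
  have hmem : ∀ v (x : M v), e.1 v x.1 = x.1 := by
    rintro v ⟨_, x, rfl⟩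
    exact hi v x
  let f : ∀ k, M (s k) →ₗ[F] M (t k) := fun k =>
    (A.f k ∘ₗ (LinearMap.range (e.1 (s k))).subtype).codRestrict _ (by
      rintro ⟨_, x, rfl⟩
      exact ⟨A.f k x, by simp [hc]⟩)
  refine ⟨ofMod M f, fromOfMod M f A (fun v => (LinearMap.range (e.1 v)).subtype) ?_,
    toOfMod M f A (fun v => (e.1 v).rangeRestrict) ?_, ?_, ?_⟩
  · intro k
    rfl
  · intro k
    apply LinearMap.ext
    intro x
    apply Subtype.ext
    exact hc k x
  · refine hom_ext fun v => ?_
    apply LinearMap.ext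
    intro x
    change coordEq M v ((e.1 v).rangeRestrict ((coordEq M v).symm x).1) = x
    have : (e.1 v).rangeRestrict ((coordEq M v).symm x).1 = (coordEq M v).symm x :=
      Subtype.ext (hmem v _)
    exact (congrArg _ this).trans ((coordEq M v).apply_symm_apply x)
  · refine hom_ext fun v => ?_
    apply LinearMap.ext
    intro x
    simp only [comp_val, toOfMod, fromOfMod, LinearMap.comp_apply, LinearEquiv.coe_coe]
    exact congrArg Subtype.val ((coordEq M v).symm_apply_apply _)

theorem dim_Dec {A : QObj F s t} {X : Type} [Fintype X] {N : X → QObj F s t} (D : Dec A N)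
    (v : V) : A.α v = ∑ x, (N x).α v := by
  classical
  have key : ∀ x y : X, ∀ z, (D.prj y).1 v ((D.inj x).1 v z) =
      (Pi.single (M := fun x => (N x).U v) x z) y := by
    intro x y z
    by_cases h : x = y
    · subst h
      rw [Pi.single_eq_same]
      exact LinearMap.congr_fun (congrArg (fun g : N x ⟶ N x => g.1 v) (D.self x)) z
    · rw [Pi.single_eq_of_ne (Ne.symm h)]
      exact LinearMap.congr_fun (congrArg (fun g : N x ⟶ N y => g.1 v) (D.ne x y h)) z
  let eqv : A.U v ≃ₗ[F] (∀ x, (N x).U v) :=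
    LinearEquiv.ofLinearMap (LinearMap.pi fun x => (D.prj x).1 v)
      (∑ x, (D.inj x).1 v ∘ₗ LinearMap.proj x)
      (by
        apply LinearMap.ext
        intro b
        funext y
        simp only [LinearMap.comp_apply, LinearMap.pi_apply, LinearMap.sum_apply, map_sum, key,
          LinearMap.id_apply, LinearMap.proj_apply]
        rw [Finset.sum_eq_single y]
        · simp
        · intro x _ hx
          exact Pi.single_eq_of_ne (Ne.symm hx) _
        · simp)
      (by
        have := congrArg (fun g : A ⟶ A => g.1 v) D.total
        simp only [sum_val, comp_val, id_val] at this
        apply LinearMap.ext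
        intro b
        have := LinearMap.congr_fun this b
        simpa using this)
  have h1 := eqv.finrank_eq
  have h2 : Module.finrank F (∀ x, (N x).U v) = ∑ x, Module.finrank F ((N x).U v) :=
    Module.finrank_pi_fintype F
  rw [h2, Module.finrank_fin_fun] at h1
  rw [h1]
  exact Finset.sum_congr rfl fun x _ => Module.finrank_fin_fun F

theorem dim_iso {A B : QObj F s t} (e : A ≅ B) : A.α = B.α := by
  funext v
  have := dim_Dec (Dec.single e) v
  simpa using this

theorem exists_Dec_indec [Fintype V] (A : QObj F s t) : ∃ (X : Type) (_ : Fintype X)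
    (N : X → QObj F s t), (∀ x, Indec (N x)) ∧ Nonempty (Dec A N) := by
  induction hn : ∑ v, A.α v using Nat.strong_induction_on generalizing A with
  | _ n ih =>
  by_cases h0 : (1 : End A) = 0
  · exact ⟨Empty, inferInstance, fun x => x.elim, fun x => x.elim,
      ⟨⟨fun x => x.elim, fun x => x.elim, fun x => x.elim, fun x => x.elim, by
        simpa using h0.symm⟩⟩⟩
  by_cases h1 : ∀ e : End A, e * e = e → e = 0 ∨ e = 1
  · exact ⟨Unit, inferInstance, fun _ => A, fun _ => ⟨h0, h1⟩, ⟨Dec.single (Iso.refl A)⟩⟩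
  push Not at h1
  obtain ⟨e, he, he0, he1⟩ := h1
  have he' : (1 - e) * (1 - e) = 1 - e := by
    rw [mul_sub, sub_mul, sub_mul, he]; simp
  obtain ⟨B, a, b, hab, hba⟩ := exists_split A e he
  obtain ⟨B', a', b', hab', hba'⟩ := exists_split A (1 - e : End A) he'
  have hz : a ≫ b' = 0 := by
    have h2 : (1 - e) * e = 0 := by rw [sub_mul, he, one_mul, sub_self]
    have h3 : (b ≫ a) ≫ (b' ≫ a') = 0 := by rw [hba, hba']; exact h2
    calc a ≫ b' = (a ≫ b) ≫ a ≫ b' ≫ (a' ≫ b') := by rw [hab, hab']; simp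
      _ = a ≫ ((b ≫ a) ≫ (b' ≫ a')) ≫ b' := by simp only [Category.assoc]
      _ = 0 := by rw [h3]; simp
  have hz' : a' ≫ b = 0 := by
    have h2 : e * (1 - e) = 0 := by rw [mul_sub, he, mul_one, sub_self]
    have h3 : (b' ≫ a') ≫ (b ≫ a) = 0 := by rw [hba, hba']; exact h2
    calc a' ≫ b = (a' ≫ b') ≫ a' ≫ b ≫ (a ≫ b) := by rw [hab, hab']; simp
      _ = a' ≫ ((b' ≫ a') ≫ (b ≫ a)) ≫ b := by simp only [Category.assoc]
      _ = 0 := by rw [h3]; simp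
  have hadd : b ≫ a + b' ≫ a' = 𝟙 A := by
    rw [hba, hba']
    exact add_sub_cancel e (1 : End A)
  let P : Bool → QObj F s t := fun x => bif x then B else B'
  let D : Dec A P :=
    { inj := fun x => match x with
        | true => a
        | false => a'
      prj := fun x => match x with
        | true => b
        | false => b'
      self := fun x => match x with
        | true => hab
        | false => hab'
      ne := fun x y h => match x, y with
        | true, true => absurd rfl h
        | false, false => absurd rfl h
        | true, false => hz
        | false, true => hz'
      total := by rw [Fintype.sum_bool]; exact hadd }
  have hpos : ∀ {B : QObj F s t} (a : B ⟶ A) (b : A ⟶ B), b ≫ a ≠ 0 → 0 < ∑ v, B.α v := by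
    intro B a b h
    by_contra h2
    apply h
    have h3 : ∀ v, B.α v = 0 := by
      intro v
      have := Finset.sum_eq_zero_iff.1 (Nat.eq_zero_of_not_pos h2) v (Finset.mem_univ v)
      exact this
    refine hom_ext fun v => ?_
    have : Subsingleton (B.U v) := by
      unfold QObj.U; rw [h3 v]; infer_instance
    apply LinearMap.ext
    intro x
    rw [comp_val, LinearMap.comp_apply, Subsingleton.elim (b.1 v x) 0, map_zero]
    rfl
  have hsum : ∑ v, A.α v = ∑ v, B.α v + ∑ v, B'.α v := by
    rw [← Finset.sum_add_distrib]
    refine Finset.sum_congr rfl fun v _ => ?_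
    rw [dim_Dec D v, Fintype.sum_bool]
    rfl
  have p1 := hpos a b (by rw [hba]; exact he0)
  have p2 := hpos a' b' (by rw [hba']; exact fun h => he1 (sub_eq_zero.1 h).symm)
  have hP : ∀ x, ∃ (X : Type) (_ : Fintype X)
    (N : X → QObj F s t), (∀ x, Indec (N x)) ∧ Nonempty (Dec (P x) N) := by
    intro x
    cases x
    · exact ih _ (by omega) B' rfl
    · exact ih _ (by omega) B rfl
  choose Y hY N hN hD using hP
  exact ⟨Σ x, Y x, inferInstance, fun z => N z.1 z.2, fun z => hN _ _,
    ⟨D.bind fun x => (hD x).some⟩⟩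

end

section
variable (F : Type) [Field F] [Finite F] {V E : Type} [Fintype V] (s t : E → V)

def isoSetoid : Setoid (QObj F s t) where
  r A B := Nonempty (A ≅ B)
  iseqv := ⟨fun A => ⟨Iso.refl A⟩, fun ⟨e⟩ => ⟨e.symm⟩, fun ⟨e⟩ ⟨e'⟩ => ⟨e.trans e'⟩⟩

def repr (A : QObj F s t) : QObj F s t := (Quotient.mk (isoSetoid F s t) A).out

theorem repr_iso (A : QObj F s t) : Nonempty (repr F s t A ≅ A) :=
  Quotient.exact (s := isoSetoid F s t) (Quotient.out_eq _)

theorem repr_eq {A B : QObj F s t} (e : A ≅ B) : repr F s t A = repr F s t B := by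
  unfold repr
  rw [Quotient.sound (s := isoSetoid F s t) (show Nonempty (A ≅ B) from ⟨e⟩)]

theorem indec_rho {A : QObj F s t} (h : Indec A) : ∃ ρ : End A →ₐ[F] AlgebraicClosure F,
    ∀ x, ρ x = 0 ↔ IsNilpotent x := by
  have : Finite (End A) := end_finite A
  have : Nontrivial (End A) := ⟨1, 0, h.1⟩
  exact exists_rho F _ (End A) h.2

def qsys : Sys F (AlgebraicClosure F) (QObj F s t) where
  I := {A : QObj F s t // Indec A ∧ repr F s t A = A}
  N i := i.1
  indec i := i.2.1
  eq_of_iso i j e := Subtype.ext (by rw [← i.2.2, ← j.2.2]; exact repr_eq F s t e)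
  ρ i := (indec_rho F s t i.2.1).choose
  hρ i := (indec_rho F s t i.2.1).choose_spec

theorem exists_qsys_iso {A : QObj F s t} (h : Indec A) :
    ∃ i : (qsys F s t).I, Nonempty (A ≅ (qsys F s t).N i) := by
  obtain ⟨e⟩ := repr_iso F s t A
  exact ⟨⟨repr F s t A, h.ofIso e.symm, repr_eq F s t e⟩, ⟨e.symm⟩⟩

theorem exists_Dec (A : QObj F s t) : ∃ (X : Type) (_ : Fintype X)
    (c : X → (qsys F s t).I), Nonempty (Dec A fun x => (qsys F s t).N (c x)) := by
  obtain ⟨X, _, N, hN, ⟨D⟩⟩ := exists_Dec_indec A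
  choose c hc using fun x => exists_qsys_iso F s t (hN x)
  exact ⟨Σ _ : X, Unit, inferInstance, fun z => c z.1,
    ⟨D.bind (Y := fun _ => Unit) (N' := fun x _ => (qsys F s t).N (c x))
      fun x => Dec.single (hc x).some⟩⟩

theorem qsys_hsum (M : QObj F s t) (e : End M) (he : e * e = e) (h0 : e ≠ 0) :
    ∃ (i : (qsys F s t).I) (a : (qsys F s t).N i ⟶ M) (b : M ⟶ (qsys F s t).N i),
      a ≫ b = 𝟙 _ ∧ e ≫ b = b := by
  obtain ⟨B, a, b, hab, hba⟩ := exists_split M e he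
  obtain ⟨X, _, c, ⟨D⟩⟩ := exists_Dec F s t B
  by_cases hX : IsEmpty X
  · exfalso
    apply h0
    have := D.total
    rw [Finset.univ_eq_empty, Finset.sum_empty] at this
    refine hba.symm.trans ?_
    calc b ≫ a = b ≫ 𝟙 B ≫ a := by simp
      _ = 0 := by rw [← this]; simp
  · rw [not_isEmpty_iff] at hX
    obtain ⟨x⟩ := hX
    refine ⟨c x, D.inj x ≫ a, b ≫ D.prj x, ?_, ?_⟩
    · rw [Category.assoc, ← Category.assoc a, hab, Category.id_comp, D.self]
    · have : e ≫ b = b := by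
        rw [← hba, Category.assoc, hab, Category.comp_id]
      rw [← Category.assoc, this]
end
end KacProof

set_option linter.all false
namespace KacProof
open CategoryTheory Polynomial

theorem count_map_univ {X I : Type} [Fintype X] [DecidableEq I] (c : X → I) (i : I) :
    (Finset.univ.val.map c).count i = Fintype.card {x // c x = i} := by
  rw [Multiset.count_map, Fintype.card_subtype, Finset.card_def, Finset.filter_val]
  simp only [eq_comm]

theorem exists_equiv_of_map_eq {X Y I : Type} [Fintype X] [Fintype Y] (c : X → I) (c' : Y → I)
    (h : Finset.univ.val.map c = Finset.univ.val.map c') : ∃ e : X ≃ Y, ∀ x, c' (e x) = c x := by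
  classical
  have : ∀ i, Nonempty ({x // c x = i} ≃ {y // c' y = i}) := by
    intro i
    have h1 := count_map_univ c i
    have h2 := count_map_univ c' i
    rw [← Fintype.card_eq, Fintype.card_eq_nat_card, Fintype.card_eq_nat_card]
    rw [Fintype.card_eq_nat_card] at h1 h2
    rw [← h1, ← h2, h]
  let e := fun i => (this i).some
  refine ⟨(Equiv.sigmaFiberEquiv c).symm.trans
    ((Equiv.sigmaCongrRight e).trans (Equiv.sigmaFiberEquiv c')), fun x => ?_⟩
  exact (e (c x) ⟨x, rfl⟩).2

section
variable (F : Type) [Field F] [Finite F] {V E : Type} [Fintype V] (s t : E → V)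

def HasType (A : QObj F s t) (m : Multiset (qsys F s t).I) : Prop :=
  ∃ (X : Type) (_ : Fintype X) (c : X → (qsys F s t).I),
    Nonempty (Dec A fun x => (qsys F s t).N (c x)) ∧ Finset.univ.val.map c = m

variable {F s t}

theorem HasType.exists (A : QObj F s t) : ∃ m, HasType F s t A m := by
  obtain ⟨X, hX, c, h⟩ := exists_Dec F s t A
  exact ⟨_, X, hX, c, h, rfl⟩

theorem exists_fin {K : Type} (m : Multiset K) :
    ∃ (n : ℕ) (c : Fin n → K), Finset.univ.val.map c = m := by
  induction m using Quotient.inductionOn with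
  | _ l =>
  refine ⟨l.length, l.get, ?_⟩
  rw [Fin.univ_val_map, List.ofFn_get]
  rfl

theorem HasType.obj (m : Multiset (qsys F s t).I) : ∃ A, HasType F s t A m := by
  obtain ⟨_, c, hc⟩ := exists_fin m
  obtain ⟨A, hA⟩ := exists_sum (fun x => (qsys F s t).N (c x))
  exact ⟨A, _, _, c, hA, hc⟩

theorem HasType.dec {A : QObj F s t} {X : Type} [Fintype X] {c : X → (qsys F s t).I}
    (h : HasType F s t A (Finset.univ.val.map c)) :
    Nonempty (Dec A fun x => (qsys F s t).N (c x)) := by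
  obtain ⟨Y, _, c', ⟨D⟩, hc⟩ := h
  obtain ⟨e, he⟩ := exists_equiv_of_map_eq c c' hc.symm
  have := D.reindex e
  simp only [he] at this
  exact ⟨this⟩

theorem HasType.congr {A B : QObj F s t} {m} (h : HasType F s t A m) (e : A ≅ B) :
    HasType F s t B m := by
  obtain ⟨Y, _, c', ⟨D⟩, hc⟩ := h
  exact ⟨Y, _, c', ⟨D.congrIso e⟩, hc⟩

theorem HasType.iso_iff {A B : QObj F s t} {m m'} (h : HasType F s t A m)
    (h' : HasType F s t B m') : Nonempty (A ≅ B) ↔ m = m' := by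
  classical
  constructor
  · rintro ⟨e⟩
    obtain ⟨X, _, c, ⟨D⟩, rfl⟩ := h
    obtain ⟨Y, _, c', ⟨D'⟩, rfl⟩ := h'
    ext i
    rw [count_map_univ, count_map_univ]
    exact Sys.card_fiber_eq (qsys F s t) D D' e i
  · rintro rfl
    obtain ⟨X, _, c, ⟨D⟩, rfl⟩ := h
    obtain ⟨D'⟩ := h'.dec
    exact ⟨D.ofIso D'⟩

theorem HasType.dim {A : QObj F s t} {m} (h : HasType F s t A m) :
    A.α = (m.map fun i => i.1.α).sum := by
  obtain ⟨X, _, c, ⟨D⟩, rfl⟩ := h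
  funext v
  rw [dim_Dec D v, Multiset.map_map]
  change _ = (∑ x, (c x).1.α) v
  rw [Finset.sum_apply]
  rfl

theorem HasType.single (i : (qsys F s t).I) : HasType F s t i.1 {i} :=
  ⟨Unit, inferInstance, fun _ => i, ⟨Dec.single (Iso.refl i.1)⟩, by simp⟩

theorem dim_ne_zero (i : (qsys F s t).I) : i.1.α ≠ 0 := by
  intro h
  apply i.2.1.1
  refine hom_ext fun v => ?_
  have : Subsingleton (i.1.U v) := by
      unfold QObj.U; rw [h]; exact inferInstanceAs (Subsingleton (Fin 0 → F))
  exact Subsingleton.elim _ _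

theorem wt_type {E' : Type} {s' t' : E' → V} {K : Type} {a : K → (qsys F s t).I}
    {a' : K → (qsys F s' t').I} (ha : Function.Injective a) (ha' : Function.Injective a')
    (hn : ∀ k, (qsys F s t).n (a k) = (qsys F s' t').n (a' k)) (m : Multiset K)
    {A : QObj F s t} {A' : QObj F s' t'} (h : HasType F s t A (m.map a))
    (h' : HasType F s' t' A' (m.map a')) (p : F[X]) : wt p A = wt p A' := by
  obtain ⟨_, c, rfl⟩ := exists_fin m
  rw [Multiset.map_map] at h h'
  obtain ⟨D⟩ := h.dec
  obtain ⟨D'⟩ := h'.dec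
  rw [wt_Dec (qsys F s t) (qsys_hsum F s t) D p, wt_Dec (qsys F s' t') (qsys_hsum F s' t') D' p]
  simp only [Function.comp_apply, hn, ne_eq, ha.eq_iff, ha'.eq_iff]
end
end KacProof

set_option linter.all false
namespace KacProof
open CategoryTheory Polynomial

section
variable {F U W : Type} [Field F] [AddCommGroup U] [AddCommGroup W] [Module F U] [Module F W]
  [FiniteDimensional F U] [FiniteDimensional F W]

/-- the commutator map -/
def cmt (P : Module.End F U) (Q : Module.End F W) : (U →ₗ[F] W) →ₗ[F] (U →ₗ[F] W) where
  toFun A := Q ∘ₗ A - A ∘ₗ P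
  map_add' A B := by rw [LinearMap.comp_add, LinearMap.add_comp]; abel
  map_smul' r A := by
    rw [LinearMap.comp_smul, LinearMap.smul_comp, smul_sub]; rfl

def trp : (W →ₗ[F] U) →ₗ[F] Module.Dual F (U →ₗ[F] W) where
  toFun B :=
    { toFun := fun A => LinearMap.trace F U (B ∘ₗ A)
      map_add' := fun A A' => by rw [LinearMap.comp_add, map_add]
      map_smul' := fun r A => by rw [LinearMap.comp_smul, map_smul]; rfl }
  map_add' B B' := by
    apply LinearMap.ext; intro A
    change LinearMap.trace F U ((B + B') ∘ₗ A) = _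
    rw [LinearMap.add_comp, map_add]; rfl
  map_smul' r B := by
    apply LinearMap.ext; intro A
    change LinearMap.trace F U ((r • B) ∘ₗ A) = _
    rw [LinearMap.smul_comp, map_smul]; rfl

theorem trp_inj : Function.Injective (trp : (W →ₗ[F] U) →ₗ[F] Module.Dual F (U →ₗ[F] W)) := by
  rw [injective_iff_map_eq_zero]
  intro B hB
  apply LinearMap.ext
  intro w
  rw [LinearMap.zero_apply, ← Module.forall_dual_apply_eq_zero_iff F]
  intro f
  have h1 : LinearMap.trace F U (B ∘ₗ f.smulRight w) = 0 := LinearMap.congr_fun hB _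
  have h2 : B ∘ₗ f.smulRight w = f.smulRight (B w) := by
    apply LinearMap.ext; intro x; simp
  rw [h2, LinearMap.trace_smulRight] at h1
  exact h1

theorem finrank_ker_cmt_le (P : Module.End F U) (Q : Module.End F W) :
    Module.finrank F (LinearMap.ker (cmt Q P)) ≤ Module.finrank F (LinearMap.ker (cmt P Q)) := by
  have h1 : Module.finrank F (LinearMap.ker (cmt P Q).dualMap) =
      Module.finrank F (LinearMap.ker (cmt P Q)) := by
    have a := LinearMap.finrank_range_add_finrank_ker (cmt P Q).dualMap
    have b := LinearMap.finrank_range_add_finrank_ker (cmt P Q)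
    have c := LinearMap.finrank_range_dualMap_eq_finrank_range (cmt P Q)
    have d := Subspace.dual_finrank_eq (K := F) (V := U →ₗ[F] W)
    omega
  rw [← h1]
  refine LinearMap.finrank_le_finrank_of_injective
    (f := (trp ∘ₗ (LinearMap.ker (cmt Q P)).subtype).codRestrict
      (LinearMap.ker (cmt P Q).dualMap) ?_) ?_
  · rintro ⟨B, hB⟩
    rw [LinearMap.mem_ker]
    have hB' : P ∘ₗ B = B ∘ₗ Q := sub_eq_zero.1 hB
    apply LinearMap.ext
    intro A
    change LinearMap.trace F U (B ∘ₗ (Q ∘ₗ A - A ∘ₗ P)) = 0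
    rw [LinearMap.comp_sub, map_sub, ← LinearMap.comp_assoc, ← hB', LinearMap.comp_assoc,
      ← LinearMap.comp_assoc]
    have := LinearMap.trace_mul_comm F P (B ∘ₗ A)
    rw [sub_eq_zero]
    exact this
  · intro a b hab
    apply Subtype.ext
    exact trp_inj (congrArg Subtype.val hab)

theorem card_comm (P : Module.End F U) (Q : Module.End F W) [Finite F] :
    Nat.card {A : U →ₗ[F] W // Q ∘ₗ A = A ∘ₗ P} = Nat.card {B : W →ₗ[F] U // P ∘ₗ B = B ∘ₗ Q} := by
  have key : ∀ {U W : Type} [AddCommGroup U] [AddCommGroup W] [Module F U] [Module F W]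
    [FiniteDimensional F U] [FiniteDimensional F W] (P : Module.End F U) (Q : Module.End F W),
    Nat.card {A : U →ₗ[F] W // Q ∘ₗ A = A ∘ₗ P} =
      Nat.card F ^ Module.finrank F (LinearMap.ker (cmt P Q)) := by
    intro U W _ _ _ _ _ _ P Q
    rw [← Module.natCard_eq_pow_finrank]
    exact Nat.card_congr (Equiv.subtypeEquivRight fun A => by
      rw [LinearMap.mem_ker]; exact sub_eq_zero.symm)
  rw [key, key, le_antisymm (finrank_ker_cmt_le P Q) (finrank_ker_cmt_le Q P)]
end

section
variable {F : Type} [Field F] [Finite F] {V E : Type} [Fintype V] {s t : E → V}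

/-- families of endomorphisms -/
abbrev Th (F : Type) [Field F] {V : Type} (α : V → ℕ) : Type :=
  ∀ v, Module.End F (Fin (α v) → F)

def endVal (A : QObj F s t) : End A →ₐ[F] Th F A.α where
  toFun θ := θ.1
  map_one' := rfl
  map_mul' f g := rfl
  map_zero' := rfl
  map_add' f g := rfl
  commutes' r := rfl

theorem endVal_inj (A : QObj F s t) : Function.Injective (endVal A) :=
  fun _ _ h => Subtype.ext h

theorem nilp_iff (A : QObj F s t) (θ : End A) (p : F[X]) :
    IsNilpotent (aeval θ p) ↔ IsNilpotent (aeval (endVal A θ) p) := by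
  rw [aeval_algHom_apply]
  exact (IsNilpotent.map_iff (endVal_inj A)).symm

/-- commuting pairs count -/
def tot [Fintype E] (s t : E → V) (α : V → ℕ) (p : F[X]) : ℕ :=
  Nat.card {x : CoordRep F s t α × Th F α // (∀ e, x.2 (t e) ∘ₗ x.1 e = x.1 e ∘ₗ x.2 (s e)) ∧
    IsNilpotent (aeval x.2 p)}

instance th_finite (α : V → ℕ) : Finite (Th F α) := by
  have : ∀ v, Finite (Module.End F (Fin (α v) → F)) := fun v => DFunLike.finite _
  infer_instance

instance rep_finite [Fintype E] (s t : E → V) (α : V → ℕ) : Finite (CoordRep F s t α) := by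
  have : ∀ v w, Finite ((Fin (α v) → F) →ₗ[F] (Fin (α w) → F)) := fun v w => DFunLike.finite _
  unfold CoordRep
  infer_instance

theorem tot_eq [Fintype E] (s t : E → V) (α : V → ℕ) (p : F[X]) :
    tot s t α p = Nat.card (Σ θ : {θ : Th F α // IsNilpotent (aeval θ p)},
      ∀ e, {A : (Fin (α (s e)) → F) →ₗ[F] (Fin (α (t e)) → F) //
        θ.1 (t e) ∘ₗ A = A ∘ₗ θ.1 (s e)}) := by
  refine Nat.card_congr
    { toFun := fun x => ⟨⟨x.1.2, x.2.2⟩, fun e => ⟨x.1.1 e, x.2.1 e⟩⟩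
      invFun := fun y => ⟨(fun e => (y.2 e).1, y.1.1), fun e => (y.2 e).2, y.1.2⟩
      left_inv := fun x => rfl
      right_inv := fun y => rfl }

theorem tot_orient {E' : Type} [Fintype E] [Fintype E'] (s t : E → V) (s' t' : E' → V)
    (φ : E ≃ E')
    (hφ : ∀ e : E, (s' (φ e) = s e ∧ t' (φ e) = t e) ∨ (s' (φ e) = t e ∧ t' (φ e) = s e))
    (α : V → ℕ) (p : F[X]) : tot s t α p = tot s' t' α p := by
  have : ∀ v w, Finite ((Fin (α v) → F) →ₗ[F] (Fin (α w) → F)) := fun v w => DFunLike.finite _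
  rw [tot_eq, tot_eq]
  refine Nat.card_congr (Equiv.sigmaCongrRight fun θ => Nonempty.some ?_)
  refine (Finite.card_eq).1 ?_
  rw [Nat.card_pi, Nat.card_pi]
  have key : ∀ v w : V, Nat.card {A : (Fin (α v) → F) →ₗ[F] (Fin (α w) → F) //
        θ.1 w ∘ₗ A = A ∘ₗ θ.1 v} = Nat.card {A : (Fin (α w) → F) →ₗ[F] (Fin (α v) → F) //
        θ.1 v ∘ₗ A = A ∘ₗ θ.1 w} := fun v w => card_comm _ _
  refine Fintype.prod_equiv φ _ _ fun e => ?_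
  rcases hφ e with ⟨h1, h2⟩ | ⟨h1, h2⟩
  · rw [h1, h2]
  · rw [h1, h2]; exact key _ _

end
end KacProof

set_option linter.all false
namespace KacProof
open CategoryTheory Polynomial

section
variable {F : Type} [Field F] [Finite F] {V E : Type} [Fintype V] [Fintype E] {s t : E → V}

abbrev GG (F : Type) [Field F] {V : Type} (α : V → ℕ) : Type :=
  ∀ v, (Fin (α v) → F) ≃ₗ[F] (Fin (α v) → F)

instance gg_finite (α : V → ℕ) : Finite (GG F α) := by
  have : ∀ v, Finite ((Fin (α v) → F) ≃ₗ[F] (Fin (α v) → F)) := fun v => DFunLike.finite _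
  infer_instance

def isoEquiv (α : V → ℕ) (f f' : CoordRep F s t α) :
    {g : GG F α // ∀ e, (g (t e)).toLinearMap ∘ₗ f e = f' e ∘ₗ (g (s e)).toLinearMap} ≃
      ((⟨α, f⟩ : QObj F s t) ≅ ⟨α, f'⟩) where
  toFun g :=
    { hom := ⟨fun v => (g.1 v).toLinearMap, g.2⟩
      inv := ⟨fun v => (g.1 v).symm.toLinearMap, fun e => by
        apply LinearMap.ext
        intro x
        have := LinearMap.congr_fun (g.2 e) ((g.1 (s e)).symm x)
        change g.1 (t e) (f e ((g.1 (s e)).symm x)) =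
          f' e (g.1 (s e) ((g.1 (s e)).symm x)) at this
        rw [LinearEquiv.apply_symm_apply] at this
        change (g.1 (t e)).symm (f' e x) = f e ((g.1 (s e)).symm x)
        rw [← this, LinearEquiv.symm_apply_apply]⟩
      hom_inv_id := hom_ext fun v => by
        apply LinearMap.ext
        intro x
        exact (g.1 v).symm_apply_apply x
      inv_hom_id := hom_ext fun v => by
        apply LinearMap.ext
        intro x
        exact (g.1 v).apply_symm_apply x }
  invFun i := ⟨fun v => LinearEquiv.ofLinearMap (i.hom.1 v) (i.inv.1 v)
      (congrArg (fun g : (⟨α, f'⟩ : QObj F s t) ⟶ ⟨α, f'⟩ => g.1 v) i.inv_hom_id)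
      (congrArg (fun g : (⟨α, f⟩ : QObj F s t) ⟶ ⟨α, f⟩ => g.1 v) i.hom_inv_id),
    fun e => i.hom.2 e⟩
  left_inv g := by
    apply Subtype.ext
    funext v
    apply LinearEquiv.ext
    intro x
    rfl
  right_inv i := by
    apply Iso.ext
    rfl

theorem repIso_iff (α : V → ℕ) (f f' : CoordRep F s t α) :
    RepIso F s t α f f' ↔ Nonempty ((⟨α, f⟩ : QObj F s t) ≅ ⟨α, f'⟩) := by
  rw [← (isoEquiv α f f').nonempty_congr, nonempty_subtype]
  rfl

def nilC (A : QObj F s t) (p : F[X]) : ℕ := Nat.card {θ : End A // IsNilpotent (aeval θ p)}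
def unC (A : QObj F s t) : ℕ := Nat.card {θ : End A // IsUnit θ}

theorem wt_eq (A : QObj F s t) (p : F[X]) : wt p A = (nilC A p : ℚ) / unC A := rfl

theorem unC_pos (A : QObj F s t) : 0 < unC A := by
  have := end_finite A
  have : Nonempty {θ : End A // IsUnit θ} := ⟨⟨1, isUnit_one⟩⟩
  exact Nat.card_pos

theorem card_aut (A : QObj F s t) : Nat.card (A ≅ A) = unC A := by
  unfold unC
  refine Nat.card_congr (((Aut.unitsEndEquivAut A).toEquiv.symm).trans
    (Equiv.ofBijective (fun u : (End A)ˣ => (⟨u.1, u.isUnit⟩ : {θ : End A // IsUnit θ})) ⟨?_, ?_⟩))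
  · intro u v h
    exact Units.ext (congrArg Subtype.val h)
  · rintro ⟨_, u, rfl⟩
    exact ⟨u, rfl⟩

theorem nilC_iso {A B : QObj F s t} (e : A ≅ B) (p : F[X]) : nilC A p = nilC B p := by
  have key : ∀ {A B : QObj F s t} (e : A ≅ B) (p : F[X]) (θ : End A),
      IsNilpotent (aeval θ p) → IsNilpotent (aeval (e.conj θ) p) := by
    intro A B e p θ h
    let c : End A →ₐ[F] End B :=
      { toFun := e.conj
        map_one' := map_one e.conj
        map_mul' := map_mul e.conj
        map_zero' := by
          change e.inv ≫ (0 : A ⟶ A) ≫ e.hom = 0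
          simp
        map_add' := fun x y => by
          exact (congrArg (fun z => e.inv ≫ z) (Preadditive.add_comp _ _ _ x y e.hom)).trans
            (Preadditive.comp_add _ _ _ _ _ _)
        commutes' := fun r => by
          change e.inv ≫ (r • 𝟙 A) ≫ e.hom = r • 𝟙 B
          simp }
    change IsNilpotent (aeval (c θ) p)
    rw [aeval_algHom_apply]
    exact h.map c
  refine Nat.card_congr (e.conj.toEquiv.subtypeEquiv fun θ => ⟨key e p θ, fun h => ?_⟩)
  have := key e.symm p _ h
  rwa [show e.symm.conj (e.conj.toEquiv θ) = θ from e.conj.symm_apply_apply θ] at this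

variable (F s t) in
def tp (A : QObj F s t) : Multiset (qsys F s t).I := (HasType.exists A).choose

theorem tp_spec (A : QObj F s t) : HasType F s t A (tp F s t A) := (HasType.exists A).choose_spec

variable (F s t) in
abbrev TT (α : V → ℕ) : Type :=
  {m : Multiset (qsys F s t).I // (m.map fun i => i.1.α).sum = α}

def tpm (α : V → ℕ) (f : CoordRep F s t α) : TT F s t α :=
  ⟨tp F s t ⟨α, f⟩, (tp_spec _).dim.symm⟩

theorem exists_of_TT {α : V → ℕ} (m : TT F s t α) :
    ∃ f : CoordRep F s t α, HasType F s t ⟨α, f⟩ m.1 := by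
  obtain ⟨⟨β, f⟩, hA⟩ := HasType.obj m.1
  have h : β = α := hA.dim.trans m.2
  subst h
  exact ⟨f, hA⟩

theorem tpm_surj (α : V → ℕ) : Function.Surjective (tpm (s := s) (t := t) (F := F) α) := by
  intro m
  obtain ⟨f, hf⟩ := exists_of_TT m
  refine ⟨f, Subtype.ext ?_⟩
  exact ((tp_spec _).iso_iff hf).1 ⟨Iso.refl _⟩

theorem tpm_eq_iff {α : V → ℕ} {f f' : CoordRep F s t α} :
    tpm α f = tpm α f' ↔ Nonempty ((⟨α, f⟩ : QObj F s t) ≅ ⟨α, f'⟩) := by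
  rw [Subtype.ext_iff]
  exact ((tp_spec _).iso_iff (tp_spec _)).symm

instance tt_finite (α : V → ℕ) : Finite (TT F s t α) := Finite.of_surjective _ (tpm_surj α)

theorem orbit_card {α : V → ℕ} (f0 : CoordRep F s t α) :
    Nat.card {f // tpm α f = tpm α f0} * unC (⟨α, f0⟩ : QObj F s t) = Nat.card (GG F α) := by
  classical
  have e1 : GG F α ≃ Σ f : CoordRep F s t α,
      {g : GG F α // ∀ e, (g (t e)).toLinearMap ∘ₗ f0 e = f e ∘ₗ (g (s e)).toLinearMap} :=
    { toFun := fun g => ⟨fun e => (g (t e)).toLinearMap ∘ₗ f0 e ∘ₗ (g (s e)).symm.toLinearMap, g,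
        fun e => by
          apply LinearMap.ext
          intro x
          change g (t e) (f0 e x) = g (t e) (f0 e ((g (s e)).symm (g (s e) x)))
          rw [LinearEquiv.symm_apply_apply]⟩
      invFun := fun y => y.2.1
      left_inv := fun g => rfl
      right_inv := by
        rintro ⟨f, g, hg⟩
        have : (fun e => (g (t e)).toLinearMap ∘ₗ f0 e ∘ₗ (g (s e)).symm.toLinearMap) = f := by
          funext e
          apply LinearMap.ext
          intro x
          have := LinearMap.congr_fun (hg e) ((g (s e)).symm x)
          change g (t e) (f0 e ((g (s e)).symm x)) =
            f e (g (s e) ((g (s e)).symm x)) at this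
          rw [LinearEquiv.apply_symm_apply] at this
          exact this
        subst this
        rfl }
  have e2 : (Σ f : {f // tpm α f = tpm α f0},
      ((⟨α, f0⟩ : QObj F s t) ≅ ⟨α, f.1⟩)) ≃
      Σ f : CoordRep F s t α,
      {g : GG F α // ∀ e, (g (t e)).toLinearMap ∘ₗ f0 e = f e ∘ₗ (g (s e)).toLinearMap} :=
    { toFun := fun y => ⟨y.1.1, (isoEquiv α f0 y.1.1).symm y.2⟩
      invFun := fun y => ⟨⟨y.1, tpm_eq_iff.2 ⟨(isoEquiv α f0 y.1 y.2).symm⟩⟩, isoEquiv α f0 y.1 y.2⟩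
      left_inv := fun y => by
        rcases y with ⟨⟨f, hf⟩, i⟩
        simp
      right_inv := fun y => by
        rcases y with ⟨f, i⟩
        simp }
  have e3 : (Σ f : {f // tpm α f = tpm α f0}, ((⟨α, f0⟩ : QObj F s t) ≅ ⟨α, f.1⟩)) ≃
      {f // tpm α f = tpm α f0} × ((⟨α, f0⟩ : QObj F s t) ≅ ⟨α, f0⟩) :=
    (Equiv.sigmaCongrRight fun f => (tpm_eq_iff.1 f.2).some.isoCongrRight).trans
      (Equiv.sigmaEquivProd _ _)
  rw [Nat.card_congr (e1.trans (e2.symm.trans e3)), Nat.card_prod, card_aut]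

theorem tot_eq_sum (α : V → ℕ) (p : F[X]) [Fintype (CoordRep F s t α)] :
    tot s t α p = ∑ f : CoordRep F s t α, nilC (⟨α, f⟩ : QObj F s t) p := by
  have : ∀ f : CoordRep F s t α, Finite {θ : End (⟨α, f⟩ : QObj F s t) // IsNilpotent (aeval θ p)} :=
    fun f => by
      have := end_finite (⟨α, f⟩ : QObj F s t)
      infer_instance
  unfold tot nilC
  rw [← Nat.card_sigma]
  refine Nat.card_congr
    { toFun := fun x => ⟨x.1.1, ⟨⟨x.1.2, x.2.1⟩, (nilp_iff _ _ _).2 x.2.2⟩⟩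
      invFun := fun y => ⟨(y.1, y.2.1.1), y.2.1.2, (nilp_iff _ _ _).1 y.2.2⟩
      left_inv := fun x => rfl
      right_inv := fun y => rfl }

def sec {α : V → ℕ} (m : TT F s t α) : QObj F s t := ⟨α, (exists_of_TT m).choose⟩

theorem sec_spec {α : V → ℕ} (m : TT F s t α) : HasType F s t (sec m) m.1 :=
  (exists_of_TT m).choose_spec

theorem tot_eq_sum_TT (α : V → ℕ) (p : F[X]) [Fintype (TT F s t α)] :
    (tot s t α p : ℚ) = Nat.card (GG F α) * ∑ m : TT F s t α, wt p (sec m) := by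
  classical
  have := Fintype.ofFinite (CoordRep F s t α)
  rw [tot_eq_sum, ← Finset.sum_fiberwise_of_maps_to (t := Finset.univ) (g := tpm α)
    (fun _ _ => Finset.mem_univ _), Nat.cast_sum, Finset.mul_sum]
  refine Finset.sum_congr rfl fun m _ => ?_
  let f0 := (exists_of_TT m).choose
  have h0 : tpm α f0 = m := Subtype.ext (((tp_spec _).iso_iff (sec_spec m)).1 ⟨Iso.refl _⟩)
  have h1 : ∀ f ∈ Finset.univ.filter (fun f => tpm α f = m),
      nilC (⟨α, f⟩ : QObj F s t) p = nilC (sec m) p := by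
    intro f hf
    rw [Finset.mem_filter, ← h0, tpm_eq_iff] at hf
    exact nilC_iso hf.2.some p
  rw [Finset.sum_congr rfl h1, Finset.sum_const, smul_eq_mul, ← orbit_card f0, wt_eq]
  rw [← Fintype.card_subtype, h0, Fintype.card_eq_nat_card]
  have h2 : (unC (sec m) : ℚ) ≠ 0 := by exact_mod_cast (unC_pos _).ne'
  change _ = (((Nat.card {f // tpm α f = m} * unC (sec m) : ℕ)) : ℚ) * _
  push_cast
  field_simp

end
end KacProof

set_option linter.all false
namespace KacProof
open CategoryTheory Polynomial

section
variable {F Ω : Type} [Field F] [Field Ω] [Algebra F Ω] {C : Type} [Category.{0} C]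
    [Preadditive C] [Linear F C] [hfin : ∀ X Y : C, Finite (X ⟶ Y)] (S : Sys F Ω C)

include hfin in
theorem Sys.exists_prim (i : S.I) : ((S.n i - 1 : ℕ) : Ω) ≠ 0 ∧
    ∃ z : Ω, IsPrimitiveRoot z (S.n i - 1) := by
  obtain ⟨L, hL⟩ := S.subfield i
  have hf : Finite L := by
    have := S.finrange i
    rw [← hL] at this
    exact this
  have hc : Nat.card L = S.n i := by
    unfold Sys.n
    rw [← hL]; rfl
  have h1 := S.one_lt_n i
  constructor
  · have h0 : ((S.n i : ℕ) : Ω) = 0 := by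
      rw [← hc]
      have := Fintype.ofFinite L
      have h2 : ((Fintype.card L : ℕ) : L) = 0 := Nat.cast_card_eq_zero L
      rw [← Fintype.card_eq_nat_card]
      have := congrArg L.subtype h2
      rw [map_natCast, map_zero] at this
      exact this
    rw [Nat.cast_sub h1.le, h0]
    simp
  · obtain ⟨g, hg⟩ := IsCyclic.exists_ofOrder_eq_natCard (α := Lˣ)
    have h3 : Nat.card Lˣ = S.n i - 1 := by
      rw [Nat.card_units, hc]
    refine ⟨L.subtype g.1, ?_⟩
    rw [← h3, ← hg]
    have := (IsPrimitiveRoot.orderOf g)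
    have h4 := this.map_of_injective (f := Units.coeHom L) Units.val_injective
    exact h4.map_of_injective (f := L.subtype) L.subtype.injective

include hfin in
theorem Sys.omega_ne (i : S.I) : omega Ω (cyclotomic (S.n i - 1) F) (S.n i) ≠ 0 := by
  obtain ⟨h0, z, hz⟩ := S.exists_prim i
  have h1 := S.one_lt_n i
  have hf : Finite {z : Ω // z ^ S.n i = z} := by
    have := S.finrange i
    exact Finite.of_injective (β := Set.range (S.ρ i))
      (fun z => ⟨z.1, (S.mem_range i z.1).2 z.2⟩) (fun a b h => Subtype.ext (by simpa using h))
  have hf1 : ∀ P : Ω → Prop, Finite {z : Ω // z ^ S.n i = z ∧ P z} := fun P =>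
    Finite.of_injective (β := {z : Ω // z ^ S.n i = z})
      (fun z => ⟨z.1, z.2.1⟩) (fun a b h => Subtype.ext (by simpa using h))
  have := hf1
  unfold omega
  have hne : NeZero ((S.n i - 1 : ℕ) : Ω) := ⟨h0⟩
  have n1 : Nonempty {z : Ω // z ^ S.n i = z ∧ aeval z (cyclotomic (S.n i - 1) F) = 0} := by
    refine ⟨z, ?_, ?_⟩
    · have := hz.pow_eq_one
      calc z ^ S.n i = z ^ (S.n i - 1 + 1) := by congr 1; omega
        _ = z := by rw [pow_succ, this, one_mul]
    · have := isRoot_cyclotomic_iff.2 hz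
      rw [← map_cyclotomic _ (algebraMap F Ω), IsRoot, eval_map_algebraMap] at this
      exact this
  have n2 : Nonempty {z : Ω // z ^ S.n i = z ∧ z ≠ 0} := ⟨1, one_pow _, one_ne_zero⟩
  refine div_ne_zero ?_ ?_
  · exact_mod_cast Nat.card_pos.ne'
  · exact_mod_cast Nat.card_pos.ne'

include hfin in
theorem Sys.omega_zero (i : S.I) (j : ℕ) (h1 : 1 < j) (h2 : j < S.n i) :
    omega Ω (cyclotomic (S.n i - 1) F) j = 0 := by
  obtain ⟨h0, -⟩ := S.exists_prim i
  have hne : NeZero ((S.n i - 1 : ℕ) : Ω) := ⟨h0⟩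
  have : IsEmpty {z : Ω // z ^ j = z ∧ aeval z (cyclotomic (S.n i - 1) F) = 0} := by
    constructor
    rintro ⟨z, hz, hr⟩
    have hp : IsPrimitiveRoot z (S.n i - 1) := by
      apply isRoot_cyclotomic_iff.1
      rw [← map_cyclotomic _ (algebraMap F Ω), IsRoot, eval_map_algebraMap]
      exact hr
    have hz0 : z ≠ 0 := by
      rintro rfl
      have := hp.pow_eq_one
      rw [zero_pow (by omega)] at this
      exact zero_ne_one this
    have h3 : z ^ (j - 1) = 1 := by
      apply mul_right_cancel₀ hz0
      rw [← pow_succ, one_mul]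
      rw [show j - 1 + 1 = j by omega, hz]
    have := Nat.le_of_dvd (by omega) (hp.dvd_of_pow_eq_one _ h3)
    omega
  unfold omega
  rw [Nat.card_of_isEmpty]
  simp
end

/-- separation of labels -/
theorem labels_eq {X Y P : Type} [Finite X] [Finite Y] (a : X → ℕ) (b : Y → ℕ) (w : P → ℕ → ℚ)
    (h : ∀ k, ((∃ x, a x = k) ∨ ∃ y, b y = k) → ∃ p, w p k ≠ 0 ∧
      ∀ j, ((∃ x, a x = j) ∨ ∃ y, b y = j) → j < k → w p j = 0)
    (hs : ∀ p, ∑ᶠ x, w p (a x) = ∑ᶠ y, w p (b y)) (k : ℕ) :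
    Nat.card {x // a x = k} = Nat.card {y // b y = k} := by
  classical
  have := Fintype.ofFinite X
  have := Fintype.ofFinite Y
  let S : Finset ℕ := Finset.univ.image a ∪ Finset.univ.image b
  have hS : ∀ k, k ∈ S ↔ ((∃ x, a x = k) ∨ ∃ y, b y = k) := by intro k; simp [S]
  let d : ℕ → ℚ := fun k => (Nat.card {x // a x = k} : ℚ) - Nat.card {y // b y = k}
  suffices hd : ∀ k, d k = 0 by
    have := sub_eq_zero.1 (hd k)
    exact_mod_cast this
  have hd0 : ∀ k, k ∉ S → d k = 0 := by
    intro k hk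
    rw [hS] at hk
    push Not at hk
    have : IsEmpty {x // a x = k} := ⟨fun x => hk.1 _ x.2⟩
    have : IsEmpty {y // b y = k} := ⟨fun x => hk.2 _ x.2⟩
    simp [d]
  have hsum : ∀ p, ∑ k ∈ S, d k * w p k = 0 := by
    intro p
    have h1 := hs p
    rw [finsum_eq_sum_of_fintype, finsum_eq_sum_of_fintype,
      ← Finset.sum_fiberwise_of_maps_to (t := S) (g := a) (fun x _ => (hS _).2 (Or.inl ⟨x, rfl⟩)),
      ← Finset.sum_fiberwise_of_maps_to (t := S) (g := b)
        (fun x _ => (hS _).2 (Or.inr ⟨x, rfl⟩))] at h1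
    rw [← sub_eq_zero, ← Finset.sum_sub_distrib] at h1
    refine Eq.trans (Finset.sum_congr rfl fun k _ => ?_) h1
    simp only [d, sub_mul]
    congr 1
    · rw [Finset.sum_congr rfl (g := fun _ => w p k)
        (fun x hx => by rw [(Finset.mem_filter.1 hx).2]), Finset.sum_const, nsmul_eq_mul,
        ← Fintype.card_subtype, Fintype.card_eq_nat_card]
    · rw [Finset.sum_congr rfl (g := fun _ => w p k)
        (fun x hx => by rw [(Finset.mem_filter.1 hx).2]), Finset.sum_const, nsmul_eq_mul,
        ← Fintype.card_subtype, Fintype.card_eq_nat_card]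
  by_contra hcon
  push Not at hcon
  have hne : (S.filter fun k => d k ≠ 0).Nonempty := by
    obtain ⟨k, hk⟩ := hcon
    exact ⟨k, Finset.mem_filter.2 ⟨by by_contra h2; exact hk (hd0 k h2), hk⟩⟩
  let m := (S.filter fun k => d k ≠ 0).max' hne
  have hm := Finset.mem_filter.1 (Finset.max'_mem _ hne)
  change m ∈ S ∧ d m ≠ 0 at hm
  obtain ⟨p, hp, hp0⟩ := h m ((hS m).1 hm.1)
  have h3 := hsum p
  rw [Finset.sum_eq_single_of_mem m hm.1] at h3
  · exact (mul_ne_zero hm.2 hp) h3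
  · intro j hj hjm
    rcases lt_or_gt_of_ne hjm with h4 | h4
    · rw [hp0 j ((hS j).1 hj) h4, mul_zero]
    · have : d j = 0 := by
        by_contra h5
        exact absurd (Finset.le_max' _ j (Finset.mem_filter.2 ⟨hj, h5⟩)) (not_le.2 h4)
      rw [this, zero_mul]
end KacProof

set_option linter.all false
namespace KacProof
open CategoryTheory Polynomial

section
variable {F : Type} [Field F] [Finite F] {V E : Type} [Fintype V] [Fintype E]

abbrev JJ (F : Type) [Field F] [Finite F] {V E : Type} [Fintype V] (s t : E → V) (α : V → ℕ) :
    Type := {i : (qsys F s t).I // ∑ v, i.1.α v < ∑ v, α v}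

abbrev SS (F : Type) [Field F] [Finite F] {V E : Type} [Fintype V] (s t : E → V) (α : V → ℕ) :
    Type := {i : (qsys F s t).I // i.1.α = α}

abbrev NN (F : Type) [Field F] [Finite F] {V E : Type} [Fintype V] (s t : E → V) (α : V → ℕ) :
    Type := {m : Multiset (JJ F s t α) // (m.map fun j => j.1.1.α).sum = α}

def toTT (s t : E → V) (α : V → ℕ) : SS F s t α ⊕ NN F s t α → TT F s t α :=
  Sum.elim (fun i => ⟨{i.1}, by simp [i.2]⟩)
    (fun m => ⟨m.1.map Subtype.val, by rw [Multiset.map_map]; exact m.2⟩)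

theorem toTT_bij (s t : E → V) (α : V → ℕ) : Function.Bijective (toTT (F := F) s t α) := by
  constructor
  · rintro (i | m) (j | m') h
    · have h1 : ({i.1} : Multiset (qsys F s t).I) = {j.1} := congrArg Subtype.val h
      rw [Multiset.singleton_inj] at h1
      rw [Subtype.ext h1]
    · exfalso
      have h1 : ({i.1} : Multiset (qsys F s t).I) = m'.1.map Subtype.val := congrArg Subtype.val h
      have h2 : i.1 ∈ m'.1.map Subtype.val := by rw [← h1]; simp
      obtain ⟨j, _, hj⟩ := Multiset.mem_map.1 h2
      have := j.2
      rw [hj, i.2] at this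
      exact lt_irrefl _ this
    · exfalso
      have h1 : m.1.map Subtype.val = ({j.1} : Multiset (qsys F s t).I) := congrArg Subtype.val h
      have h2 : j.1 ∈ m.1.map Subtype.val := by rw [h1]; simp
      obtain ⟨i, _, hi⟩ := Multiset.mem_map.1 h2
      have := i.2
      rw [hi, j.2] at this
      exact lt_irrefl _ this
    · have h1 : m.1.map Subtype.val = m'.1.map Subtype.val := congrArg Subtype.val h
      rw [Subtype.ext (Multiset.map_injective Subtype.val_injective h1)]
  · rintro ⟨m, hm⟩
    by_cases h : ∀ i ∈ m, ∑ v, i.1.α v < ∑ v, α v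
    · have h1 : (m.pmap (fun i hi => (⟨i, hi⟩ : JJ F s t α)) h).map Subtype.val = m := by
        rw [Multiset.map_pmap, Multiset.pmap_eq_map, Multiset.map_id']
      refine ⟨Sum.inr ⟨m.pmap (fun i hi => (⟨i, hi⟩ : JJ F s t α)) h, ?_⟩, Subtype.ext h1⟩
      have h2 := hm
      rw [← h1, Multiset.map_map] at h2
      exact h2
    · push Not at h
      obtain ⟨i, hi, hle⟩ := h
      obtain ⟨r, rfl⟩ := Multiset.exists_cons_of_mem hi
      rw [Multiset.map_cons, Multiset.sum_cons] at hm
      have hz : (r.map fun i => i.1.α).sum = 0 := by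
        set b := (r.map fun i => i.1.α).sum
        have h1 : ∑ v, i.1.α v + ∑ v, b v = ∑ v, α v := by
          rw [← Finset.sum_add_distrib, ← hm]; rfl
        have h2 : ∑ v, b v = 0 := by omega
        funext v
        exact Finset.sum_eq_zero_iff.1 h2 v (Finset.mem_univ v)
      have hr : r = 0 := by
        by_contra hr
        obtain ⟨j, hj⟩ := Multiset.exists_mem_of_ne_zero hr
        obtain ⟨r', rfl⟩ := Multiset.exists_cons_of_mem hj
        rw [Multiset.map_cons, Multiset.sum_cons] at hz
        apply dim_ne_zero j
        funext v
        have := congrFun hz v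
        simp only [Pi.add_apply, Pi.zero_apply] at this ⊢
        omega
      subst hr
      refine ⟨Sum.inl ⟨i, ?_⟩, Subtype.ext ?_⟩
      · simpa using hm
      · simp [toTT]

instance ss_finite (s t : E → V) (α : V → ℕ) : Finite (SS F s t α) :=
  Finite.of_injective (fun x => toTT (F := F) s t α (Sum.inl x))
    fun a b h => Sum.inl_injective ((toTT_bij s t α).1 h)

instance nn_finite (s t : E → V) (α : V → ℕ) : Finite (NN F s t α) :=
  Finite.of_injective (fun x => toTT (F := F) s t α (Sum.inr x))
    fun a b h => Sum.inr_injective ((toTT_bij s t α).1 h)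

theorem wt_same {s t : E → V} {A A' : QObj F s t} {m} (h : HasType F s t A m)
    (h' : HasType F s t A' m) (p : F[X]) : wt p A = wt p A' :=
  wt_type (a := id) (a' := id) Function.injective_id Function.injective_id (fun _ => rfl) m
    (by simpa using h) (by simpa using h') p

theorem tot_split (s t : E → V) (α : V → ℕ) (p : F[X]) [Fintype (SS F s t α)]
    [Fintype (NN F s t α)] : (tot s t α p : ℚ) = Nat.card (GG F α) *
      (∑ i : SS F s t α, omega (AlgebraicClosure F) p ((qsys F s t).n i.1) +
        ∑ m : NN F s t α, wt p (sec (toTT s t α (Sum.inr m)))) := by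
  have := Fintype.ofFinite (TT F s t α)
  rw [tot_eq_sum_TT, ← (Equiv.ofBijective _ (toTT_bij s t α)).sum_comp, Fintype.sum_sum_type]
  congr 2
  refine Finset.sum_congr rfl fun i _ => ?_
  rw [← Sys.wt_N]
  exact wt_same (sec_spec _) (HasType.single i.1) p

theorem gg_pos (α : V → ℕ) : 0 < Nat.card (GG F α) := by
  have : Nonempty (GG F α) := ⟨fun v => LinearEquiv.refl _ _⟩
  exact Nat.card_pos

theorem main_step {E' : Type} [Fintype E'] (s t : E → V) (s' t' : E' → V) (φ : E ≃ E')
    (hφ : ∀ e : E, (s' (φ e) = s e ∧ t' (φ e) = t e) ∨ (s' (φ e) = t e ∧ t' (φ e) = s e))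
    (α : V → ℕ) (σ : JJ F s t α ≃ JJ F s' t' α) (hσ : ∀ j, (σ j).1.1.α = j.1.1.α)
    (hn : ∀ j, (qsys F s t).n j.1 = (qsys F s' t').n (σ j).1) (p : F[X]) :
    ∑ᶠ i : SS F s t α, omega (AlgebraicClosure F) p ((qsys F s t).n i.1) =
    ∑ᶠ i : SS F s' t' α, omega (AlgebraicClosure F) p ((qsys F s' t').n i.1) := by
  have := Fintype.ofFinite (SS F s t α)
  have := Fintype.ofFinite (SS F s' t' α)
  have := Fintype.ofFinite (NN F s t α)
  have := Fintype.ofFinite (NN F s' t' α)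
  rw [finsum_eq_sum_of_fintype, finsum_eq_sum_of_fintype]
  have h1 := tot_split (F := F) s t α p
  rw [tot_orient s t s' t' φ hφ, tot_split (F := F) s' t' α p] at h1
  have h2 := mul_left_cancel₀ (by exact_mod_cast (gg_pos α).ne') h1
  have hσ' : ∀ j, (σ.symm j).1.1.α = j.1.1.α := by
    intro j
    rw [← hσ, σ.apply_symm_apply]
  let τ : NN F s t α ≃ NN F s' t' α :=
    { toFun := fun m => ⟨m.1.map σ, by
        rw [Multiset.map_map]
        refine Eq.trans ?_ m.2
        congr 1
        exact Multiset.map_congr rfl fun j _ => hσ j⟩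
      invFun := fun m => ⟨m.1.map σ.symm, by
        rw [Multiset.map_map]
        refine Eq.trans ?_ m.2
        congr 1
        exact Multiset.map_congr rfl fun j _ => hσ' j⟩
      left_inv := fun m => Subtype.ext (by simp)
      right_inv := fun m => Subtype.ext (by simp) }
  have h3 : ∑ m : NN F s t α, wt p (sec (toTT s t α (Sum.inr m))) =
      ∑ m : NN F s' t' α, wt p (sec (toTT s' t' α (Sum.inr m))) := by
    refine Fintype.sum_equiv τ _ _ fun m => ?_
    refine wt_type (a := fun j : JJ F s t α => j.1) (a' := fun j => (σ j).1)
      Subtype.val_injective (Subtype.val_injective.comp σ.injective) hn m.1 (sec_spec _) ?_ p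
    have := sec_spec (toTT s' t' α (Sum.inr (τ m)))
    have h4 : (toTT s' t' α (Sum.inr (τ m))).1 = m.1.map fun j => (σ j).1 := by
      change (m.1.map σ).map Subtype.val = _
      rw [Multiset.map_map]; rfl
    rw [h4] at this
    exact this
  rw [h3] at h2
  exact (add_right_cancel h2).symm

theorem main_count {E' : Type} [Fintype E'] (s t : E → V) (s' t' : E' → V) (φ : E ≃ E')
    (hφ : ∀ e : E, (s' (φ e) = s e ∧ t' (φ e) = t e) ∨ (s' (φ e) = t e ∧ t' (φ e) = s e))
    (α : V → ℕ) (k : ℕ) :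
    Nat.card {i : SS F s t α // (qsys F s t).n i.1 = k} =
      Nat.card {i : SS F s' t' α // (qsys F s' t').n i.1 = k} := by
  induction hN : ∑ v, α v using Nat.strong_induction_on generalizing α k with
  | _ N ih =>
  have hfib : ∀ βk : (V → ℕ) × ℕ, Nonempty
      ({j : JJ F s t α // (j.1.1.α, (qsys F s t).n j.1) = βk} ≃
        {j : JJ F s' t' α // (j.1.1.α, (qsys F s' t').n j.1) = βk}) := by
    rintro ⟨β, k⟩
    by_cases hβ : ∑ v, β v < ∑ v, α v
    · have e : ∀ {E : Type} (s t : E → V),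
        {j : JJ F s t α // (j.1.1.α, (qsys F s t).n j.1) = (β, k)} ≃
          {i : SS F s t β // (qsys F s t).n i.1 = k} := fun s t =>
        { toFun := fun j => ⟨⟨j.1.1, (Prod.ext_iff.1 j.2).1⟩, (Prod.ext_iff.1 j.2).2⟩
          invFun := fun i => ⟨⟨i.1.1, by rw [i.1.2]; exact hβ⟩, Prod.ext i.1.2 i.2⟩
          left_inv := fun _ => rfl
          right_inv := fun _ => rfl }
      have h1 := ih _ (hN ▸ hβ) β k rfl
      exact ⟨(e s t).trans ((Finite.card_eq.1 h1).some.trans (e s' t').symm)⟩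
    · have e : ∀ {E : Type} (s t : E → V),
        IsEmpty {j : JJ F s t α // (j.1.1.α, (qsys F s t).n j.1) = (β, k)} := fun s t =>
        ⟨fun j => hβ (by rw [← show j.1.1.1.α = β from (Prod.ext_iff.1 j.2).1]; exact j.1.2)⟩
      have := e s t
      have := e s' t'
      exact ⟨Equiv.equivOfIsEmpty _ _⟩
  let e := fun x => (hfib x).some
  let d := fun j : JJ F s t α => (j.1.1.α, (qsys F s t).n j.1)
  let d' := fun j : JJ F s' t' α => (j.1.1.α, (qsys F s' t').n j.1)
  let σ : JJ F s t α ≃ JJ F s' t' α := (Equiv.sigmaFiberEquiv d).symm.trans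
    ((Equiv.sigmaCongrRight e).trans (Equiv.sigmaFiberEquiv d'))
  have hσ : ∀ j, d' (σ j) = d j := fun j => (e (d j) ⟨j, rfl⟩).2
  refine labels_eq (P := F[X]) (fun i : SS F s t α => (qsys F s t).n i.1)
    (fun i : SS F s' t' α => (qsys F s' t').n i.1) (fun p n => omega (AlgebraicClosure F) p n)
    ?_ (fun p => main_step s t s' t' φ hφ α σ (fun j => (Prod.ext_iff.1 (hσ j)).1)
      (fun j => (Prod.ext_iff.1 (hσ j)).2.symm) p) k
  have hgt : ∀ j, ((∃ x : SS F s t α, (qsys F s t).n x.1 = j) ∨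
      ∃ y : SS F s' t' α, (qsys F s' t').n y.1 = j) → 1 < j := by
    rintro j (⟨x, rfl⟩ | ⟨x, rfl⟩)
    · exact Sys.one_lt_n _ _
    · exact Sys.one_lt_n _ _
  rintro k (⟨x, rfl⟩ | ⟨x, rfl⟩)
  · exact ⟨_, Sys.omega_ne _ _, fun j hj hjk => Sys.omega_zero _ _ j (hgt j hj) hjk⟩
  · exact ⟨_, Sys.omega_ne _ _, fun j hj hjk => Sys.omega_zero _ _ j (hgt j hj) hjk⟩
end
end KacProof

set_option linter.all false
namespace KacProof
open CategoryTheory Polynomial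

theorem fitting {Ω V E : Type} [Field Ω] [Fintype V] {s t : E → V} (M : V → Type)
    [∀ v, AddCommGroup (M v)] [∀ v, Module Ω (M v)] [∀ v, FiniteDimensional Ω (M v)]
    (f : ∀ e, M (s e) →ₗ[Ω] M (t e)) (h : IsIndecRep Ω s t M f)
    (T : ∀ v, Module.End Ω (M v)) (hT : ∀ e x, T (t e) (f e x) = f e (T (s e) x)) :
    (∃ n, ∀ v, T v ^ n = 0) ∨ ∀ v, Function.Injective (T v) := by
  have hev : ∀ᶠ n in Filter.atTop, ∀ v, IsCompl (LinearMap.ker (T v ^ n)) (LinearMap.range (T v ^ n)) := by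
    rw [Filter.eventually_all]
    exact fun v => LinearMap.eventually_isCompl_ker_pow_range_pow (T v)
  obtain ⟨n, hn, hn1⟩ := (hev.and (Filter.eventually_ge_atTop 1)).exists
  have hTn : ∀ e x, (T (t e) ^ n) (f e x) = f e ((T (s e) ^ n) x) := by
    intro e
    induction n with
    | zero => simp
    | succ n ih =>
      clear hn hn1
      have : ∀ n x, (T (t e) ^ n) (f e x) = f e ((T (s e) ^ n) x) := by
        intro n
        induction n with
        | zero => simp
        | succ n ih => intro x; rw [pow_succ, pow_succ, Module.End.mul_apply, hT, ih]; rfl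
      exact this _
  have hA : ∀ e, (LinearMap.ker (T (s e) ^ n)).map (f e) ≤ LinearMap.ker (T (t e) ^ n) := by
    rintro e _ ⟨x, hx, rfl⟩
    have hx : (T (s e) ^ n) x = 0 := hx
    change (T (t e) ^ n) (f e x) = 0
    rw [hTn, hx, map_zero]
  have hB : ∀ e, (LinearMap.range (T (s e) ^ n)).map (f e) ≤ LinearMap.range (T (t e) ^ n) := by
    rintro e _ ⟨_, ⟨x, rfl⟩, rfl⟩
    exact ⟨f e x, hTn e x⟩
  rcases h.2 _ _ hn hA hB with h1 | h1
  · right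
    intro v
    have h2 := LinearMap.ker_eq_bot.1 (h1 v)
    obtain ⟨m, rfl⟩ : ∃ m, n = m + 1 := ⟨n - 1, by omega⟩
    rw [pow_succ] at h2
    exact Function.Injective.of_comp (f := (T v ^ m : Module.End Ω (M v))) h2
  · left
    exact ⟨n, fun v => LinearMap.range_eq_bot.1 (h1 v)⟩

theorem alg_frob {K R : Type} [Field K] [Ring R] [Algebra K R] (p m : ℕ) [Fact p.Prime] [CharP R p]
    (x : R) (a : K) (h : (x - algebraMap K R a) ^ p ^ m = 0) :
    x ^ p ^ m = algebraMap K R (a ^ p ^ m) := by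
  have hc : Commute x (algebraMap K R a) := (Algebra.commutes a x).symm
  rw [sub_pow_char_pow_of_commute p m hc, ← map_pow, sub_eq_zero] at h
  exact h

/-- the local condition: indecomposable with split residue field -/
def PP {F : Type} [Field F] {V E : Type} {s t : E → V} (A : QObj F s t) : Prop :=
  Indec A ∧ ∀ θ : End A, ∃ a : F, IsNilpotent (θ - algebraMap F (End A) a)

section
variable {F : Type} [Field F] [Finite F] {V E : Type} [Fintype V] {s t : E → V}

local notation "Ω" => AlgebraicClosure F

theorem one_tmul_inj {U : Type} [AddCommGroup U] [Module F U] (x y : U)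
    (h : (1 : Ω) ⊗ₜ[F] x = 1 ⊗ₜ y) : x = y :=
  Module.FaithfullyFlat.tensorProduct_mk_injective (A := F) (B := Ω) U h

theorem bc_inj {U : Type} [AddCommGroup U] [Module F U] {f g : Module.End F U}
    (h : f.baseChange Ω = g.baseChange Ω) : f = g := by
  apply LinearMap.ext
  intro x
  apply one_tmul_inj (F := F)
  have := LinearMap.congr_fun h (1 ⊗ₜ x)
  simpa using this

theorem comm_bc (A : QObj F s t) (θ : End A) (e : E) (x : Ω ⊗[F] A.U (s e)) :
    (θ.1 (t e)).baseChange Ω ((A.f e).baseChange Ω x) =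
      (A.f e).baseChange Ω ((θ.1 (s e)).baseChange Ω x) := by
  rw [← LinearMap.comp_apply, ← LinearMap.baseChange_comp, θ.2 e, LinearMap.baseChange_comp]
  rfl

theorem PP_of_abs (A : QObj F s t) (h : IsAbsIndecRep F s t (fun v => Fin (A.α v) → F) A.f) :
    PP A := by
  have fit := fun T hT => fitting (fun v => Ω ⊗[F] A.U v) _ h T hT
  obtain ⟨v0, y0, hy0⟩ := h.1
  have hU : ∃ x : A.U v0, x ≠ 0 := by
    by_contra hc
    push Not at hc
    apply hy0
    induction y0 using TensorProduct.induction_on with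
    | zero => rfl
    | tmul a x => rw [hc x, TensorProduct.tmul_zero]
    | add a b ha hb =>
      have : ∀ y : Ω ⊗[F] A.U v0, y = 0 := by
        intro y
        induction y using TensorProduct.induction_on with
        | zero => rfl
        | tmul a x => rw [hc x, TensorProduct.tmul_zero]
        | add a b ha hb => rw [ha, hb, add_zero]
      exact this _
  obtain ⟨x0, hx0⟩ := hU
  refine ⟨⟨?_, ?_⟩, ?_⟩
  · intro h1
    apply hx0
    have : (𝟙 A : A ⟶ A) = 0 := h1
    have := LinearMap.congr_fun (congrArg (fun g : A ⟶ A => g.1 v0) this) x0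
    exact this
  · intro e he
    have hev : ∀ v, e.1 v * e.1 v = e.1 v := fun v => congrArg (fun g : A ⟶ A => g.1 v) he
    rcases fit (fun v => (e.1 v).baseChange Ω) (comm_bc A e) with ⟨n, hn⟩ | h1
    · left
      refine hom_ext fun v => ?_
      apply bc_inj
      have h2 : IsIdempotentElem ((e.1 v).baseChange Ω) := by
        unfold IsIdempotentElem
        rw [← LinearMap.baseChange_mul, hev]
      have h3 := hn v
      rcases Nat.eq_zero_or_pos n with rfl | hpos
      · rw [pow_zero] at h3
        rw [← one_mul ((e.1 v).baseChange Ω), h3, zero_mul]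
        exact LinearMap.baseChange_zero.symm
      · obtain ⟨m, rfl⟩ : ∃ m, n = m + 1 := ⟨n - 1, by omega⟩
        rw [h2.pow_succ_eq] at h3
        rw [h3]
        exact LinearMap.baseChange_zero.symm
    · right
      refine hom_ext fun v => ?_
      apply LinearMap.ext
      intro x
      apply one_tmul_inj (F := F)
      apply h1 v
      have := LinearMap.congr_fun (hev v) x
      simp only [LinearMap.baseChange_tmul]
      exact congrArg _ this
  · intro θ
    have : Nontrivial (Ω ⊗[F] A.U v0) := ⟨⟨y0, 0, hy0⟩⟩
    obtain ⟨z, hz⟩ := Module.End.exists_eigenvalue ((θ.1 v0).baseChange Ω)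
    obtain ⟨w, hw⟩ := hz.exists_hasEigenvector
    let T : ∀ v, Module.End Ω (Ω ⊗[F] A.U v) := fun v => (θ.1 v).baseChange Ω - algebraMap Ω _ z
    have hT : ∀ v x, T v x = (θ.1 v).baseChange Ω x - z • x := fun v x => rfl
    have hTc : ∀ e x, T (t e) ((A.f e).baseChange Ω x) = (A.f e).baseChange Ω (T (s e) x) := by
      intro e x
      rw [hT, hT, comm_bc, map_sub, map_smul]
    rcases fit T hTc with ⟨n, hn⟩ | h1
    · obtain ⟨p, hp⟩ := CharP.exists F
      have := hp
      have hpp : Fact p.Prime := ⟨CharP.char_is_prime F p⟩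
      have := Fintype.ofFinite F
      obtain ⟨k, hk, hcard⟩ := FiniteField.card F p
      have hCΩ : CharP Ω p := charP_of_injective_algebraMap (algebraMap F Ω).injective p
      have hle : n ≤ p ^ (k * n : ℕ) := by
        calc n ≤ k * n := Nat.le_mul_of_pos_left _ k.pos
          _ ≤ _ := (Nat.lt_pow_self hpp.out.one_lt).le
      have hTq : ∀ v, T v ^ (p ^ (k * n : ℕ)) = 0 := fun v => by
        rw [← Nat.sub_add_cancel hle, pow_add, hn, mul_zero]
      have hE : CharP (Module.End Ω (Ω ⊗[F] A.U v0)) p :=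
        charP_of_injective_algebraMap (R := Ω) (FaithfulSMul.algebraMap_injective _ _) p
      let X : Module.End Ω (Ω ⊗[F] A.U v0) := (θ.1 v0).baseChange Ω
      have h1 : (X - algebraMap Ω (Module.End Ω (Ω ⊗[F] A.U v0)) z) ^ p ^ (k * n : ℕ) = 0 := hTq v0
      have hc : Commute X (algebraMap Ω (Module.End Ω (Ω ⊗[F] A.U v0)) z) :=
        (Algebra.commutes z X).symm
      have h1 := alg_frob p _ X z h1
      rw [← LinearMap.baseChange_pow] at h1
      have h2 := LinearMap.congr_fun h1 (1 ⊗ₜ x0)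
      rw [LinearMap.baseChange_tmul, Module.algebraMap_end_apply, TensorProduct.smul_tmul',
        smul_eq_mul, mul_one] at h2
      obtain ⟨l, hl⟩ := Module.Projective.exists_dual_eq_one F hx0
      let lam : Ω ⊗[F] A.U v0 →ₗ[F] Ω := (TensorProduct.rid F Ω).toLinearMap ∘ₗ l.lTensor Ω
      have hlam : ∀ (a : Ω) x, lam (a ⊗ₜ x) = l x • a := fun a x => by simp [lam]
      have h3 := congrArg lam h2
      rw [hlam, hlam, hl, one_smul] at h3
      set a0 : F := l (((θ.1 v0) ^ p ^ (k * n : ℕ)) x0) with ha0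
      have h4 : a0 ^ p ^ (k * n : ℕ) = a0 := by
        rw [pow_mul, ← hcard, FiniteField.pow_card_pow]
      have h5 : z = algebraMap F Ω a0 := by
        apply iterateFrobenius_inj Ω p (k * n)
        rw [iterateFrobenius_def, iterateFrobenius_def, ← h3, ← map_pow, h4,
          Algebra.algebraMap_eq_smul_one]
      refine ⟨a0, n, ?_⟩
      apply endVal_inj A
      rw [map_pow, map_sub, map_zero, AlgHom.commutes]
      funext v
      apply bc_inj
      have h6 := hn v
      change ((θ.1 v - algebraMap F _ a0) ^ n).baseChange Ω = (0 : Module.End F (A.U v)).baseChange Ω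
      rw [LinearMap.baseChange_pow, LinearMap.baseChange_sub, LinearMap.baseChange_zero, ← h6]
      congr 1
      congr 1
      rw [h5]
      apply LinearMap.ext
      intro x
      induction x using TensorProduct.induction_on with
      | zero => simp
      | tmul a x =>
        rw [LinearMap.baseChange_tmul, Module.algebraMap_end_apply, Module.algebraMap_end_apply,
          TensorProduct.tmul_smul, algebraMap_smul]
      | add a b ha hb => rw [map_add, map_add, ha, hb]
    · exfalso
      apply hw.2
      apply h1 v0
      rw [hT, hw.apply_eq_smul, sub_self, map_zero]
end

end KacProof

set_option linter.all false
namespace KacProof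
open CategoryTheory Polynomial

theorem filt (R : Type) [Ring R] [Finite R]
    (h : ∀ y ν : R, IsNilpotent ν → IsNilpotent (y * ν)) :
    ∃ (r : ℕ) (K : ℕ → Set R), 1 ∈ K 0 ∧ (∀ x ∈ K r, x = 0) ∧
      ∀ k ν μ, IsNilpotent ν → μ ∈ K k → ν * μ ∈ K (k + 1) := by
  obtain ⟨r, hr⟩ : IsNilpotent (Ideal.jacobson (⊥ : Ideal R)) :=
    IsArtinianRing.isNilpotent_jacobson_bot
  refine ⟨r, fun k => (((Ideal.jacobson (⊥ : Ideal R)) ^ k : Ideal R) : Set R), ?_, ?_, ?_⟩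
  · change (1 : R) ∈ (Ideal.jacobson (⊥ : Ideal R)) ^ 0
    rw [Submodule.pow_zero, Ideal.one_eq_top]; trivial
  · intro x hx
    change x ∈ (Ideal.jacobson (⊥ : Ideal R)) ^ r at hx
    rw [hr] at hx
    exact hx
  · intro k ν μ hν hμ
    have : ν ∈ Ideal.jacobson (⊥ : Ideal R) := by
      rw [Ideal.mem_jacobson_iff]
      intro y
      obtain ⟨u, hu⟩ := (h y ν hν).isUnit_add_one
      refine ⟨(u⁻¹ : Rˣ), ?_⟩
      have h2 : ((u⁻¹ : Rˣ) : R) * (y * ν + 1) = 1 := by rw [← hu]; exact u.inv_mul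
      rw [mul_add, mul_one, ← mul_assoc] at h2
      rw [h2, sub_self]
      exact zero_mem _
    change ν * μ ∈ (Ideal.jacobson (⊥ : Ideal R)) ^ (k + 1)
    rw [Ideal.IsTwoSided.pow_succ]
    exact Ideal.mul_mem_mul this hμ

section
variable {F : Type} [Field F] [Finite F] {V E : Type} [Fintype V] {s t : E → V}

local notation "Ω" => AlgebraicClosure F

theorem filtA {A : QObj F s t} (h : Indec A) :
    ∃ (r : ℕ) (K : ℕ → Set (End A)), 1 ∈ K 0 ∧ (∀ x ∈ K r, x = 0) ∧
      ∀ k ν μ, IsNilpotent ν → μ ∈ K k → ν * μ ∈ K (k + 1) := by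
  obtain ⟨ρ, hρ⟩ := indec_rho F s t h
  have : Finite (End A) := hom_finite A A
  refine filt (End A) fun y ν hν => ?_
  rw [← hρ, map_mul, (hρ ν).2 hν, mul_zero]

def cmap {U ι : Type} [AddCommGroup U] [Module F U] [DecidableEq ι]
    (b : Module.Basis ι F Ω) (i : ι) : Ω ⊗[F] U →ₗ[F] U :=
  Finsupp.lapply i ∘ₗ (TensorProduct.equivFinsuppOfBasisLeft (N := U) b).toLinearMap

theorem cmap_tmul {U ι : Type} [AddCommGroup U] [Module F U] [DecidableEq ι]
    (b : Module.Basis ι F Ω) (i : ι) (a : Ω) (x : U) : cmap b i (a ⊗ₜ x) = b.repr a i • x := by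
  simp [cmap]

theorem cmap_nat {U W ι : Type} [AddCommGroup U] [Module F U] [AddCommGroup W] [Module F W]
    [DecidableEq ι]
    (b : Module.Basis ι F Ω) (i : ι) (f : U →ₗ[F] W) (x : Ω ⊗[F] U) :
    cmap b i (f.baseChange Ω x) = f (cmap b i x) := by
  induction x using TensorProduct.induction_on with
  | zero => simp only [map_zero]
  | tmul a x => rw [LinearMap.baseChange_tmul, cmap_tmul, cmap_tmul, map_smul]
  | add x y hx hy => simp only [map_add, hx, hy]

theorem exp_basis {U ι : Type} [AddCommGroup U] [Module F U] [DecidableEq ι]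
    (b : Module.Basis ι F Ω) (y : Ω ⊗[F] U) :
    ∃ J : Finset ι, ∀ I0 : Finset ι, J ⊆ I0 → y = ∑ i ∈ I0, b i ⊗ₜ (cmap b i y) := by
  refine ⟨(TensorProduct.equivFinsuppOfBasisLeft (N := U) b y).support, fun I0 h => ?_⟩
  conv_lhs => rw [← (TensorProduct.equivFinsuppOfBasisLeft (N := U) b).symm_apply_apply y]
  rw [TensorProduct.equivFinsuppOfBasisLeft_symm_apply, Finsupp.sum_of_support_subset _ h]
  · rfl
  intro i _; exact TensorProduct.tmul_zero _ _

theorem step {A : QObj F s t} {ι : Type} (v : V) (e : Module.End Ω (Ω ⊗[F] A.U v))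
    (I0 : Finset ι) (b : ι → Ω) (θ : ι → End A)
    (he : ∀ x, e (1 ⊗ₜ x) = ∑ i ∈ I0, b i ⊗ₜ (θ i).1 v x) (a : ι → F)
    (ha : ∀ i, IsNilpotent (θ i - algebraMap F (End A) (a i)))
    (r : ℕ) (K : ℕ → Set (End A)) (hr : ∀ x ∈ K r, x = 0)
    (hK : ∀ k ν μ, IsNilpotent ν → μ ∈ K k → ν * μ ∈ K (k + 1)) (d : ℕ) :
    ∀ k : ℕ, k + d = r →
      ∀ μ : End A, μ ∈ K k → ∀ x,
      ((e - algebraMap Ω _ (∑ i ∈ I0, a i • b i)) ^ d) (1 ⊗ₜ μ.1 v x) = 0 := by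
  induction d with
  | zero =>
    intro k hk μ hμ x
    rw [add_zero] at hk
    rw [hk] at hμ
    have : μ = 0 := hr _ hμ
    rw [this, pow_zero]
    change (1 : Ω) ⊗ₜ[F] (0 : A.U v) = 0
    rw [TensorProduct.tmul_zero]
  | succ d ih =>
    intro k hk μ hμ x
    have key : (e - algebraMap Ω (Module.End Ω (Ω ⊗[F] A.U v)) (∑ i ∈ I0, a i • b i))
        (1 ⊗ₜ μ.1 v x) =
        ∑ i ∈ I0, b i • ((1 : Ω) ⊗ₜ[F] (((θ i - algebraMap F (End A) (a i)) * μ : End A)).1 v x) := by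
      rw [LinearMap.sub_apply, he, Module.algebraMap_end_apply, Finset.sum_smul,
        ← Finset.sum_sub_distrib]
      refine Finset.sum_congr rfl fun i _ => ?_
      have h1 : (((θ i - algebraMap F (End A) (a i)) * μ : End A)).1 v x =
        (θ i).1 v (μ.1 v x) - a i • μ.1 v x := rfl
      rw [h1, TensorProduct.smul_tmul', TensorProduct.smul_tmul', smul_eq_mul, smul_eq_mul, mul_one,
        mul_one, TensorProduct.tmul_sub, TensorProduct.tmul_smul, TensorProduct.smul_tmul']
    rw [pow_succ, Module.End.mul_apply, key, map_sum]
    refine Finset.sum_eq_zero fun i _ => ?_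
    rw [map_smul, ih (k + 1) (by omega) _ (hK _ _ _ (ha i) hμ) x, smul_zero]

theorem exists_exp (A : QObj F s t) (e : ∀ v, Module.End Ω (Ω ⊗[F] A.U v))
    (ec : ∀ k x, e (t k) ((A.f k).baseChange Ω x) = (A.f k).baseChange Ω (e (s k) x)) 
    {ι : Type} [DecidableEq ι] (b : Module.Basis ι F Ω) :
    ∃ (I0 : Finset ι) (θ : ι → End A),
      ∀ v x, e v (1 ⊗ₜ x) = ∑ i ∈ I0, b i ⊗ₜ (θ i).1 v x := by
  classical
  have : Fintype (Σ v, A.U v) := Fintype.ofFinite _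
  choose g hg using fun p : (Σ v, A.U v) => exp_basis b (e p.1 (1 ⊗ₜ p.2))
  refine ⟨Finset.univ.biUnion g, fun i => ⟨fun v => cmap b i ∘ₗ
    (e v).restrictScalars F ∘ₗ TensorProduct.mk F Ω (A.U v) 1, ?_⟩, ?_⟩
  · intro k
    apply LinearMap.ext
    intro x
    change cmap b i (e (t k) (1 ⊗ₜ A.f k x)) = A.f k (cmap b i (e (s k) (1 ⊗ₜ x)))
    rw [← cmap_nat, ← ec, LinearMap.baseChange_tmul]
  · intro v x
    exact hg ⟨v, x⟩ _ (Finset.subset_biUnion_of_mem g (Finset.mem_univ (⟨v, x⟩ : Σ v, A.U v)))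

theorem abs_of_PP (A : QObj F s t) (h : PP A) :
    IsAbsIndecRep F s t (fun v => Fin (A.α v) → F) A.f := by
  classical
  constructor
  · by_contra hc
    push Not at hc
    apply h.1.1
    refine hom_ext fun v => LinearMap.ext fun x => ?_
    apply one_tmul_inj (F := F)
    rw [hc v (1 ⊗ₜ _), hc v (1 ⊗ₜ _)]
  intro W W' hW hWf hWf'
  let e : ∀ v, Module.End Ω (Ω ⊗[F] A.U v) := fun v => Submodule.projection _ _ (hW v)
  have e1 : ∀ v x, x ∈ W v → e v x = x := fun v x hx =>
    Submodule.projection_apply_of_mem_left (hW v) hx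
  have e0 : ∀ v x, x ∈ W' v → e v x = 0 := fun v x hx =>
    (Submodule.projection_apply_eq_zero_iff (hW v)).2 hx
  have ec : ∀ k x, e (t k) ((A.f k).baseChange Ω x) = (A.f k).baseChange Ω (e (s k) x) := by
    intro k x
    obtain ⟨y, hy, z, hz, rfl⟩ := Submodule.mem_sup.1 (by
      rw [(hW (s k)).sup_eq_top]; trivial : x ∈ W (s k) ⊔ W' (s k))
    rw [map_add, map_add, map_add, map_add, e1 _ _ hy, e0 _ _ hz, map_zero,
      e1 _ _ (hWf k ⟨y, hy, rfl⟩), e0 _ _ (hWf' k ⟨z, hz, rfl⟩)]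
  let b := Module.Basis.ofVectorSpace F Ω
  obtain ⟨I0, θ, he⟩ := exists_exp A e ec b
  choose a ha using fun i => h.2 (θ i)
  obtain ⟨r, K, hK1, hr, hK⟩ := filtA h.1
  set c : Ω := ∑ i ∈ I0, a i • b i with hc
  have hnil : ∀ v y, ((e v - algebraMap Ω _ c) ^ r) y = 0 := by
    intro v y
    induction y using TensorProduct.induction_on with
    | zero => exact map_zero _
    | tmul u x =>
      have h1 := step v (e v) I0 b θ (he v) a ha r K hr hK r 0 (zero_add r) 1 hK1 x
      have h2 : u ⊗ₜ[F] x = u • ((1 : Ω) ⊗ₜ[F] x) := by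
        rw [TensorProduct.smul_tmul', smul_eq_mul, mul_one]
      rw [h2, map_smul]
      exact (congrArg _ h1).trans (smul_zero _)
    | add x y hx hy => rw [map_add, hx, hy, add_zero]
  have hpow : ∀ v y (l : Ω), e v y = l • y → ∀ n : ℕ,
      ((e v - algebraMap Ω _ c) ^ n) y = (l - c) ^ n • y := by
    intro v y l hy n
    induction n with
    | zero => simp
    | succ n ih =>
      rw [pow_succ, Module.End.mul_apply, LinearMap.sub_apply, hy, Module.algebraMap_end_apply,
        show l • y - c • y = (l - c) • y from (sub_smul l c y).symm, map_smul, ih, smul_smul, pow_succ']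
  by_contra hcon
  push Not at hcon
  obtain ⟨⟨v, hv⟩, ⟨v', hv'⟩⟩ := hcon
  obtain ⟨y, hy, hy0⟩ := Submodule.exists_mem_ne_zero_of_ne_bot hv
  obtain ⟨y', hy', hy0'⟩ := Submodule.exists_mem_ne_zero_of_ne_bot hv'
  have p1 := hnil v y
  rw [hpow v y 1 (by rw [e1 _ _ hy, one_smul])] at p1
  have p2 := hnil v' y'
  rw [hpow v' y' 0 (by rw [e0 _ _ hy', zero_smul])] at p2
  have p3 := eq_zero_of_pow_eq_zero ((smul_eq_zero.1 p1).resolve_right hy0)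
  have p4 := eq_zero_of_pow_eq_zero ((smul_eq_zero.1 p2).resolve_right hy0')
  have : c = 0 := by simpa using p4
  rw [this, sub_zero] at p3
  exact one_ne_zero p3
end

end KacProof

set_option linter.all false
namespace KacProof
open CategoryTheory Polynomial

section
variable {F : Type} [Field F] [Finite F] {V E : Type} [Fintype V] {s t : E → V}

theorem PP_iso {A B : QObj F s t} (h : PP A) (e : A ≅ B) : PP B := by
  refine ⟨h.1.ofIso e, fun θ => ?_⟩
  let c : End A →ₐ[F] End B :=
    { toFun := e.conj
      map_one' := map_one e.conj
      map_mul' := map_mul e.conj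
      map_zero' := by
        change e.inv ≫ (0 : A ⟶ A) ≫ e.hom = 0
        simp
      map_add' := fun x y => by
        exact (congrArg (fun z => e.inv ≫ z) (Preadditive.add_comp _ _ _ x y e.hom)).trans
          (Preadditive.comp_add _ _ _ _ _ _)
      commutes' := fun r => by
        change e.inv ≫ (r • 𝟙 A) ≫ e.hom = r • 𝟙 B
        simp }
  obtain ⟨a, ha⟩ := h.2 (e.conj.symm θ)
  refine ⟨a, ?_⟩
  have h1 := ha.map c
  rw [map_sub, AlgHom.commutes] at h1
  have h2 : c (e.conj.symm θ) = θ := e.conj.apply_symm_apply θ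
  rwa [h2] at h1

theorem PP_iff_n (i : (qsys F s t).I) : PP ((qsys F s t).N i) ↔ (qsys F s t).n i = Nat.card F := by
  have h1 : ∀ (θ : End ((qsys F s t).N i)) (a : F), IsNilpotent (θ - algebraMap F _ a) ↔
      algebraMap F (AlgebraicClosure F) a = (qsys F s t).ρ i θ := by
    intro θ a
    rw [← (qsys F s t).hρ, map_sub, AlgHom.commutes, sub_eq_zero, eq_comm]
  have h2 : Set.range (algebraMap F (AlgebraicClosure F)) ⊆ Set.range ((qsys F s t).ρ i) := by
    rintro _ ⟨a, rfl⟩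
    exact ⟨algebraMap F _ a, AlgHom.commutes _ _⟩
  have h3 : Nat.card (Set.range (algebraMap F (AlgebraicClosure F))) = Nat.card F :=
    Nat.card_range_of_injective (algebraMap F (AlgebraicClosure F)).injective
  have h4 : PP ((qsys F s t).N i) ↔
      Set.range ((qsys F s t).ρ i) ⊆ Set.range (algebraMap F (AlgebraicClosure F)) := by
    constructor
    · rintro ⟨_, h⟩ _ ⟨θ, rfl⟩
      obtain ⟨a, ha⟩ := h θ
      exact ⟨a, (h1 θ a).1 ha⟩
    · intro h
      refine ⟨(qsys F s t).indec i, fun θ => ?_⟩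
      obtain ⟨a, ha⟩ := h ⟨θ, rfl⟩
      exact ⟨a, (h1 θ a).2 ha⟩
  have hf : (Set.range ((qsys F s t).ρ i)).Finite := (qsys F s t).finrange i
  rw [h4, ← h3]
  unfold Sys.n
  constructor
  · intro h
    rw [h.antisymm h2]
  · intro h
    exact (Set.eq_of_subset_of_ncard_le h2 (le_of_eq h) hf).ge

theorem abs_iff (α : V → ℕ) (f : CoordRep F s t α) :
    IsAbsIndecRep F s t (fun v => Fin (α v) → F) f ↔ PP (⟨α, f⟩ : QObj F s t) :=
  ⟨PP_of_abs (⟨α, f⟩ : QObj F s t), abs_of_PP (⟨α, f⟩ : QObj F s t)⟩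

theorem num_eq [Fintype E] (s t : E → V) (α : V → ℕ) : numAbsIndec F s t α =
    Nat.card {i : SS F s t α // (qsys F s t).n i.1 = Nat.card F} := by
  have hex : ∀ π : {π : CoordRep F s t α // IsAbsIndecRep F s t (fun v => Fin (α v) → F) π},
      ∃ i : {i : SS F s t α // (qsys F s t).n i.1 = Nat.card F},
        Nonempty ((⟨α, π.1⟩ : QObj F s t) ≅ (qsys F s t).N i.1.1) := by
    intro π
    have hP := (abs_iff α π.1).1 π.2
    obtain ⟨i, ⟨e⟩⟩ := exists_qsys_iso F s t hP.1
    exact ⟨⟨⟨i, (dim_iso e).symm⟩, (PP_iff_n i).1 (PP_iso hP e)⟩, ⟨e⟩⟩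
  choose g hg using hex
  have huniq : ∀ π i, Nonempty ((⟨α, π.1⟩ : QObj F s t) ≅ (qsys F s t).N i) → (g π).1.1 = i := by
    rintro π i ⟨e⟩
    exact (qsys F s t).eq_of_iso _ _ ((hg π).some.symm.trans e)
  unfold numAbsIndec
  refine Nat.card_eq_of_bijective (Quot.lift g ?_) ⟨?_, ?_⟩
  · intro π π' h
    apply Subtype.ext
    apply Subtype.ext
    exact huniq π _ ⟨((repIso_iff α _ _).1 h).some.trans (hg π').some⟩
  · intro x y
    induction x using Quot.ind with | _ π => ?_
    induction y using Quot.ind with | _ π' => ?_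
    intro h
    change g π = g π' at h
    apply Quot.sound
    refine (repIso_iff α _ _).2 ?_
    have h1 := hg π
    rw [h] at h1
    exact ⟨h1.some.trans (hg π').some.symm⟩
  · rintro ⟨⟨i, hi⟩, hn⟩
    have hP := (PP_iff_n i).2 hn
    obtain ⟨f, hf⟩ : ∃ f : CoordRep F s t α, (⟨α, f⟩ : QObj F s t) = (qsys F s t).N i := by
      subst hi
      exact ⟨i.1.f, rfl⟩
    refine ⟨Quot.mk _ ⟨f, (abs_iff α f).2 (hf ▸ hP)⟩, ?_⟩
    apply Subtype.ext
    apply Subtype.ext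
    exact huniq _ i ⟨eqToIso hf⟩
end

end KacProof

/-- If two quivers without self-loops on the same vertex set have the
same underlying graph (an edge bijection `φ` matching unordered endpoint pairs), then
for every finite field `F` and every dimension vector `α`, the number of isomorphism
classes of absolutely indecomposable representations over `F` of dimension vector `α`
is the same for the two quivers. -/
theorem indep_of_orientation {V E E' : Type} [Fintype V] [Fintype E] [Fintype E']
    (s t : E → V) (s' t' : E' → V)
    (hloop : ∀ e, s e ≠ t e) (hloop' : ∀ e, s' e ≠ t' e)
    (φ : E ≃ E')
    (hφ : ∀ e : E, (s' (φ e) = s e ∧ t' (φ e) = t e) ∨ (s' (φ e) = t e ∧ t' (φ e) = s e))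
    (F : Type) [Field F] [Fintype F] (α : V → ℕ) :
    numAbsIndec F s t α = numAbsIndec F s' t' α := by
  rw [KacProof.num_eq, KacProof.num_eq]
  exact KacProof.main_count s t s' t' φ hφ α (Nat.card F)

end
end

section
/- Let F be a field, U a finite-dimensional F-vector space, and A a quasi-nilpotent subalgebra of End_F(U). Then A, equipped with the commutator bracket [a,b] = ab − ba, is a nilpotent Lie algebra. -/
open scoped TensorProduct

noncomputable section
/-- An endomorphism `g` of a finite-dimensional `F`-vector space is quasi-nilpotent:
for some `γ` in the algebraic closure of `F`, the base change of `g` minus `γ·id`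
is nilpotent (equivalently, all eigenvalues of `g` are equal to `γ`). -/
def IsQuasiNilp (F : Type) [Field F] (U : Type) [AddCommGroup U] [Module F U]
    (g : U →ₗ[F] U) : Prop :=
  ∃ γ : AlgebraicClosure F,
    IsNilpotent (LinearMap.baseChange (AlgebraicClosure F) g
      - γ • (1 : Module.End (AlgebraicClosure F) (AlgebraicClosure F ⊗[F] U)))


/-- The lower central series of the Lie algebra spanned by `S ⊆ End_F(U)` under the
commutator bracket: `g¹ = span S`, `gʲ⁺¹ = [g, gʲ]`. -/
def lcs (F : Type) [Field F] (U : Type) [AddCommGroup U] [Module F U]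
    (S : Set (Module.End F U)) : ℕ → Submodule F (Module.End F U)
  | 0 => Submodule.span F S
  | (j + 1) => Submodule.span F
      { x | ∃ a ∈ Submodule.span F S, ∃ b ∈ lcs F U S j, x = a * b - b * a }
attribute [local instance] LieRing.ofAssociativeRing

theorem adNilp_aux (F : Type) [Field F]
    (U : Type) [AddCommGroup U] [Module F U] [FiniteDimensional F U]
    (a : Module.End F U) (ha : IsQuasiNilp F U a) :
    ∃ n : ℕ, ∀ b : Module.End F U, ((LieAlgebra.ad F (Module.End F U) a) ^ n) b = 0 := by
  obtain ⟨γ, hγ⟩ := ha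
  let K := AlgebraicClosure F
  set a' : Module.End K (K ⊗[F] U) := LinearMap.baseChange K a with ha'
  have had : LieAlgebra.ad K (Module.End K (K ⊗[F] U)) (a' - γ • 1)
      = LieAlgebra.ad K (Module.End K (K ⊗[F] U)) a' := by
    ext1 b
    simp [Ring.lie_def, sub_mul, mul_sub]
  obtain ⟨n, hn⟩ := LieAlgebra.ad_nilpotent_of_nilpotent (R := K)
    (A := Module.End K (K ⊗[F] U)) (a := a' - γ • 1) hγ
  refine ⟨n, fun b => ?_⟩
  have key : ∀ k : ℕ, LinearMap.baseChange K (((LieAlgebra.ad F (Module.End F U) a) ^ k) b)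
      = ((LieAlgebra.ad K (Module.End K (K ⊗[F] U)) a') ^ k) (LinearMap.baseChange K b) := by
    intro k
    induction k with
    | zero => simp
    | succ k ih =>
      rw [pow_succ', pow_succ', Module.End.mul_apply, Module.End.mul_apply, ← ih]
      simp only [LieAlgebra.ad_apply, Ring.lie_def, LinearMap.baseChange_sub,
        LinearMap.baseChange_mul, ha']
  have h0 := key n
  rw [← had, hn, LinearMap.zero_apply] at h0
  ext u
  have h1 := congrArg (fun f => f (1 ⊗ₜ[F] u)) h0
  simp only [LinearMap.baseChange_tmul, LinearMap.zero_apply] at h1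
  rw [LinearMap.zero_apply]
  exact (Module.FaithfullyFlat.one_tmul_eq_zero_iff F U (A := K) _).1 h1

/-- The Lie subalgebra underlying a subalgebra. -/
def lieOf (F : Type) [Field F] (U : Type) [AddCommGroup U] [Module F U]
    (A : NonUnitalSubalgebra F (Module.End F U)) : LieSubalgebra F (Module.End F U) :=
  { A.toSubmodule with
    lie_mem' := fun {x y} hx hy => A.sub_mem (A.mul_mem hx hy) (A.mul_mem hy hx) }

/-- A quasi-nilpotent (not necessarily unital) subalgebra `A` of
`End_F(U)`, `U` finite-dimensional, is a nilpotent Lie algebra under the commutator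
bracket: its lower central series reaches zero. -/
theorem lieNilpotent_of_quasiNilpotent (F : Type) [Field F]
    (U : Type) [AddCommGroup U] [Module F U] [FiniteDimensional F U]
    (A : NonUnitalSubalgebra F (Module.End F U))
    (hA : ∀ x ∈ A, IsQuasiNilp F U x) :
    ∃ m : ℕ, lcs F U (A : Set (Module.End F U)) m = ⊥ := by
  let L := lieOf F U A
  have hspan : Submodule.span F (A : Set (Module.End F U)) = A.toSubmodule :=
    Submodule.span_eq A.toSubmodule
  have hnil : LieRing.IsNilpotent L := by
    rw [LieAlgebra.isNilpotent_iff_forall (R := F)]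
    intro x
    obtain ⟨n, hn⟩ := adNilp_aux F U x.1 (hA x.1 x.2)
    refine ⟨n, ?_⟩
    have hc : ∀ (k : ℕ) (y : L), (((LieAlgebra.ad F L x) ^ k) y : Module.End F U)
        = ((LieAlgebra.ad F (Module.End F U) x.1) ^ k) y.1 := by
      intro k y
      induction k with
      | zero => simp
      | succ k ih =>
        rw [pow_succ', pow_succ', Module.End.mul_apply, Module.End.mul_apply, ← ih]
        simp
    ext1 y
    apply Subtype.ext
    rw [hc, hn]
    rfl
  have hle : ∀ j : ℕ, lcs F U (A : Set (Module.End F U)) j ≤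
      ((LieModule.lowerCentralSeries F L L j).toSubmodule).map L.toSubmodule.subtype := by
    intro j
    induction j with
    | zero =>
      intro x hx
      rw [lcs, hspan] at hx
      exact ⟨⟨x, hx⟩, by simp, rfl⟩
    | succ j ih =>
      rw [lcs, Submodule.span_le]
      rintro x ⟨a, ha, b, hb, rfl⟩
      rw [hspan] at ha
      obtain ⟨y, hy, rfl⟩ := ih hb
      refine ⟨⁅(⟨a, ha⟩ : L), y⁆, ?_, rfl⟩
      rw [LieModule.lowerCentralSeries_succ]
      exact LieSubmodule.lie_mem_lie (LieSubmodule.mem_top _) hy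
  obtain ⟨m, hm⟩ := (LieModule.isNilpotent_iff F L L).1 hnil
  refine ⟨m, ?_⟩
  have := hle m
  rw [hm] at this
  simpa using this

end
end

section
/- Let F be a field, U a finite-dimensional F-vector space, and A a subalgebra of End_F(U). If A with the commutator bracket [a,b] = ab − ba is a nilpotent Lie algebra, and A is spanned as an F-vector space by quasi-nilpotent endomorphisms, then every element of A is quasi-nilpotent. -/
open scoped TensorProduct

noncomputable section
/-- Commutators die in any image of a Lie nilpotent ring in which central nilpotent
images vanish. -/
theorem qn_commutator_zero {R E : Type*} [Ring R] [Ring E] (f : R →+* E)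
    (T : ℕ → Set R) (m : ℕ) (hT : ∀ j, ∀ a, ∀ b ∈ T j, a * b - b * a ∈ T (j + 1))
    (hm : ∀ b ∈ T m, b = 0)
    (hc : ∀ c : R, IsNilpotent (f c) → (∀ r, Commute (f r) (f c)) → f c = 0) :
    ∀ k j, j + k = m → ∀ a, ∀ b ∈ T j, f (a * b - b * a) = 0 := by
  intro k
  induction k with
  | zero =>
    intro j hj a b hb
    have : j = m := by omega
    subst this
    rw [hm b hb]; simp
  | succ k ih =>
    intro j hj a b hb
    have hcT := hT j a b hb
    have hcomm : ∀ r, Commute (f r) (f (a * b - b * a)) := by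
      intro r
      have := ih (j + 1) (by omega) r _ hcT
      rw [map_sub, map_mul f r, map_mul f _ r, sub_eq_zero] at this
      exact this
    have key : ∀ n, ∃ d ∈ T (j + n), f d = f b * f (a * b - b * a) ^ n := by
      intro n
      induction n with
      | zero => exact ⟨b, hb, by simp⟩
      | succ n ihn =>
        obtain ⟨d, hd, hfd⟩ := ihn
        refine ⟨_, hT _ (b * a) d hd, ?_⟩
        have h1 : Commute (f (b * a)) (f (a * b - b * a) ^ n) := (hcomm _).pow_right n
        have h2 : f (b * a) * f b - f b * f (b * a) = f b * f (a * b - b * a) := by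
          simp only [map_sub, map_mul]; noncomm_ring
        rw [map_sub, map_mul f _ d, map_mul f d, hfd, mul_assoc (f b), ← h1.eq, ← mul_assoc,
          ← mul_assoc, ← sub_mul, h2, mul_assoc, pow_succ']
    apply hc _ _ hcomm
    obtain ⟨d, hd, hfd⟩ := key (k + 1)
    rw [hj] at hd
    rw [hm d hd, map_zero] at hfd
    refine ⟨k + 1 + 1, ?_⟩
    have h1 : Commute (f a) (f (a * b - b * a) ^ (k + 1)) := (hcomm _).pow_right _
    have h2 : f (a * b - b * a) = f a * f b - f b * f a := by simp
    rw [pow_succ']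
    calc f (a * b - b * a) * f (a * b - b * a) ^ (k + 1)
        = (f a * f b - f b * f a) * f (a * b - b * a) ^ (k + 1) := by rw [← h2]
      _ = f a * (f b * f (a * b - b * a) ^ (k + 1))
          - f b * (f a * f (a * b - b * a) ^ (k + 1)) := by rw [sub_mul, mul_assoc, mul_assoc]
      _ = 0 := by rw [h1.eq, ← mul_assoc (f b), ← hfd]; simp

/-- A central nilpotent element lies in the Jacobson radical. -/
theorem qn_central_nilp {E : Type*} [Ring E] (c : E) (hn : IsNilpotent c)
    (hc : ∀ r, Commute r c) : c ∈ Ring.jacobson E := by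
  rw [← Ideal.jacobson_bot, Ideal.mem_jacobson_iff]
  intro y
  have h : IsNilpotent (y * c) := (hc y).isNilpotent_mul_left hn
  obtain ⟨u, hu⟩ := h.isUnit_add_one
  refine ⟨(u⁻¹ : Eˣ), ?_⟩
  have : (↑u⁻¹ : E) * (y * c + 1) = 1 := by rw [← hu]; simp
  rw [mul_add, mul_one, ← mul_assoc] at this
  rw [this]; simp

/-- In a Lie nilpotent Artinian ring, sums of nilpotents are nilpotent. -/
theorem qn_add {R : Type*} [Ring R] [IsArtinianRing R]
    (T : ℕ → Set R) (m : ℕ) (hT : ∀ j, ∀ a, ∀ b ∈ T j, a * b - b * a ∈ T (j + 1))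
    (h0 : ∀ b, b ∈ T 0) (hm : ∀ b ∈ T m, b = 0) (x y : R) (hx : IsNilpotent x)
    (hy : IsNilpotent y) : IsNilpotent (x + y) := by
  let f := Ideal.Quotient.mk (Ring.jacobson R)
  have hs : Function.Surjective f := Ideal.Quotient.mk_surjective
  have hz := qn_commutator_zero f T m hT hm (by
    intro c hc1 hc2
    have : f c ∈ Ring.jacobson (R ⧸ Ring.jacobson R) := by
      apply qn_central_nilp _ hc1
      intro r
      obtain ⟨r, rfl⟩ := hs r
      exact hc2 r
    rw [Ring.jacobson_quotient_jacobson] at this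
    exact this) m 0 (by omega) x y (h0 y)
  have hcm : Commute (f x) (f y) := by
    rw [map_sub, map_mul, map_mul, sub_eq_zero] at hz
    exact hz
  obtain ⟨n, hn⟩ := hcm.isNilpotent_add (hx.map f) (hy.map f)
  rw [← map_add, ← map_pow] at hn
  have hmem : (x + y) ^ n ∈ Ring.jacobson R := Ideal.Quotient.eq_zero_iff_mem.mp hn
  obtain ⟨k, hk⟩ := IsArtinianRing.isNilpotent_jacobson_bot (R := R)
  rw [Ideal.jacobson_bot] at hk
  refine ⟨n * k, ?_⟩
  rw [pow_mul]
  have := Ideal.pow_mem_pow hmem k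
  rw [hk] at this
  exact this

theorem qn_span_comm {K E : Type*} [Field K] [Ring E] [Algebra K E] (X Y : Set E)
    (Z : Submodule K E) (h : ∀ x ∈ X, ∀ y ∈ Y, x * y - y * x ∈ Z) (x y : E)
    (hx : x ∈ Submodule.span K X) (hy : y ∈ Submodule.span K Y) : x * y - y * x ∈ Z := by
  induction hx, hy using Submodule.span_induction₂ with
  | mem_mem u v hu hv => exact h u hu v hv
  | zero_left v hv => simp
  | zero_right u hu => simp
  | add_left u₁ u₂ v hu₁ hu₂ hv h1 h2 =>
    convert add_mem h1 h2 using 1; noncomm_ring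
  | add_right u v₁ v₂ hu hv₁ hv₂ h1 h2 =>
    convert add_mem h1 h2 using 1; noncomm_ring
  | smul_left t u v hu hv huv => simpa [smul_sub] using Submodule.smul_mem _ t huv
  | smul_right t u v hu hv huv => simpa [smul_sub] using Submodule.smul_mem _ t huv

theorem qn_add_base {F K U E : Type} [Field F] [Field K] [AddCommGroup U] [Module F U]
    [Ring E] [Algebra K E] [FiniteDimensional K E] (φ : Module.End F U →+* E)
    (A : NonUnitalSubalgebra F (Module.End F U))
    (hnil : ∃ m : ℕ, lcs F U (A : Set (Module.End F U)) m = ⊥)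
    (x y : E) (hx : x ∈ Algebra.adjoin K (φ '' A)) (hy : y ∈ Algebra.adjoin K (φ '' A))
    (hxn : IsNilpotent x) (hyn : IsNilpotent y) : IsNilpotent (x + y) := by
  obtain ⟨m, hm⟩ := hnil
  let B := Algebra.adjoin K (φ '' (A : Set (Module.End F U)))
  have : IsArtinianRing B := isArtinian_of_tower K inferInstance
  let S : ℕ → Set E := fun j => insert 1 (φ '' (lcs F U (A : Set (Module.End F U)) j))
  have hA0 : ∀ a ∈ A, a ∈ lcs F U (A : Set (Module.End F U)) 0 := fun a ha =>
    Submodule.subset_span ha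
  have hB : ∀ b ∈ B, b ∈ Submodule.span K (S 0) := by
    intro b hb
    have hb' : b ∈ Subalgebra.toSubmodule B := hb
    rw [Algebra.adjoin_eq_span] at hb'
    refine Submodule.span_mono ?_ hb'
    have : ∀ z ∈ Submonoid.closure (φ '' (A : Set (Module.End F U))),
        z = 1 ∨ ∃ a ∈ A, φ a = z := by
      intro z hz
      induction hz using Submonoid.closure_induction with
      | mem z hz => exact Or.inr hz
      | one => exact Or.inl rfl
      | mul z w _ _ h1 h2 =>
        rcases h1 with rfl | ⟨a, ha, rfl⟩
        · simpa using h2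
        · rcases h2 with rfl | ⟨b, hb, rfl⟩
          · exact Or.inr ⟨a, ha, by simp⟩
          · exact Or.inr ⟨a * b, mul_mem ha hb, by simp⟩
    intro z hz
    rcases this z hz with rfl | ⟨a, ha, rfl⟩
    · exact Or.inl rfl
    · exact Or.inr ⟨a, hA0 a ha, rfl⟩
  have hstep : ∀ j, ∀ a ∈ Submodule.span K (S 0), ∀ b ∈ Submodule.span K (S j),
      a * b - b * a ∈ Submodule.span K (φ '' (lcs F U (A : Set (Module.End F U)) (j + 1))) := by
    intro j a ha b hb
    refine qn_span_comm (S 0) (S j) _ ?_ a b ha hb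
    rintro x (rfl | ⟨x, hx, rfl⟩) y (rfl | ⟨y, hy, rfl⟩)
    · simp
    · simp
    · simp
    · refine Submodule.subset_span ⟨x * y - y * x, ?_, by simp⟩
      exact Submodule.subset_span ⟨x, hx, y, hy, rfl⟩
  have hz : lcs F U (A : Set (Module.End F U)) (m + 1) = ⊥ := by
    rw [lcs, Submodule.span_eq_bot]
    rintro x ⟨a, _, b, hb, rfl⟩
    rw [hm, Submodule.mem_bot] at hb
    simp [hb]
  let T : ℕ → Set B := fun j =>
    {b | if j = m + 1 then b = 0 else (b : E) ∈ Submodule.span K (S j)}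
  have hT : ∀ j, ∀ a, ∀ b ∈ T j, a * b - b * a ∈ T (j + 1) := by
    intro j a b hb
    have hb' : (b : E) ∈ Submodule.span K (S j) := by
      by_cases h : j = m + 1
      · have : b = 0 := by simpa [T, h] using hb
        simp [this]
      · simpa [T, h] using hb
    have h1 := hstep j a (hB _ a.2) b hb'
    by_cases h : j + 1 = m + 1
    · rw [h, hz] at h1
      have h2 : (a : E) * b - b * a = 0 := by simpa using h1
      simp only [T, h, Set.mem_ofPred_eq, if_true]
      exact Subtype.ext (by simpa using h2)
    · simp only [T, h, Set.mem_ofPred_eq, if_false]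
      exact Submodule.span_mono (Set.subset_insert _ _) (by simpa using h1)
  have h0 : ∀ b, b ∈ T 0 := by
    intro b
    simpa [T] using hB _ b.2
  have hfin := qn_add T (m + 1) hT h0 (by intro b hb; simpa [T] using hb) ⟨x, hx⟩ ⟨y, hy⟩
    (by obtain ⟨n, hn⟩ := hxn; exact ⟨n, Subtype.ext (by simpa using hn)⟩)
    (by obtain ⟨n, hn⟩ := hyn; exact ⟨n, Subtype.ext (by simpa using hn)⟩)
  simpa using hfin.map B.val

theorem qn_main {F K U E : Type} [Field F] [Field K] [Algebra F K]
    [AddCommGroup U] [Module F U] [Ring E] [Algebra K E] [FiniteDimensional K E]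
    (φ : Module.End F U →+* E)
    (hφ : ∀ (c : F) g, φ (c • g) = algebraMap F K c • φ g)
    (A : NonUnitalSubalgebra F (Module.End F U))
    (hnil : ∃ m : ℕ, lcs F U (A : Set (Module.End F U)) m = ⊥)
    (x : Module.End F U) (hx' : x ∈ Submodule.span F
      { x : Module.End F U | x ∈ A ∧ ∃ γ : K, IsNilpotent (φ x - γ • (1 : E)) }) :
    x ∈ A ∧ ∃ γ : K, IsNilpotent (φ x - γ • (1 : E)) := by
  have hmem : ∀ g ∈ A, ∀ γ : K, φ g - γ • (1 : E) ∈
      Algebra.adjoin K (φ '' (A : Set (Module.End F U))) := fun g hg γ =>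
    sub_mem (Algebra.subset_adjoin (Set.mem_image_of_mem φ hg))
      (Subalgebra.smul_mem _ (one_mem _) γ)
  induction hx' using Submodule.span_induction with
  | mem x h => exact h
  | zero => exact ⟨zero_mem _, 0, by simp⟩
  | add x y _ _ h1 h2 =>
    obtain ⟨hx, γ, hγ⟩ := h1
    obtain ⟨hy, δ, hδ⟩ := h2
    refine ⟨add_mem hx hy, γ + δ, ?_⟩
    have := qn_add_base φ A hnil _ _ (hmem x hx γ) (hmem y hy δ) hγ hδ
    convert this using 1
    rw [map_add, add_smul]
    abel
  | smul c x _ h =>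
    obtain ⟨hx, γ, hγ⟩ := h
    refine ⟨SMulMemClass.smul_mem c hx, algebraMap F K c * γ, ?_⟩
    have := hγ.smul (algebraMap F K c)
    convert this using 1
    rw [smul_sub, hφ, mul_smul]

theorem qn_main' (F K U V : Type) [Field F] [Field K] [Algebra F K]
    [AddCommGroup U] [Module F U] [AddCommGroup V] [Module K V] [FiniteDimensional K V]
    (φ : Module.End F U → Module.End K V)
    (h1 : ∀ v, φ 1 v = v) (h0 : ∀ v, φ 0 v = 0)
    (hmul : ∀ f g v, φ (f * g) v = φ f (φ g v))
    (hadd : ∀ f g v, φ (f + g) v = φ f v + φ g v)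
    (hsmul : ∀ (c : F) g v, φ (c • g) v = algebraMap F K c • φ g v)
    (A : NonUnitalSubalgebra F (Module.End F U))
    (hnil : ∃ m : ℕ, lcs F U (A : Set (Module.End F U)) m = ⊥)
    (x : Module.End F U) (hx' : x ∈ Submodule.span F
      { x : Module.End F U | x ∈ A ∧ ∃ γ : K, IsNilpotent (φ x - γ • (1 : Module.End K V)) }) :
    x ∈ A ∧ ∃ γ : K, IsNilpotent (φ x - γ • (1 : Module.End K V)) :=
  qn_main (K := K)
    { toFun := φ
      map_one' := LinearMap.ext h1
      map_mul' := fun f g => LinearMap.ext (hmul f g)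
      map_zero' := LinearMap.ext h0
      map_add' := fun f g => LinearMap.ext (hadd f g) }
    (fun c g => LinearMap.ext (hsmul c g)) A hnil x hx'

theorem qn_base (F K U : Type) [Field F] [Field K] [Algebra F K]
    [AddCommGroup U] [Module F U] [FiniteDimensional F U]
    (A : NonUnitalSubalgebra F (Module.End F U))
    (hnil : ∃ m : ℕ, lcs F U (A : Set (Module.End F U)) m = ⊥)
    (x : Module.End F U) (hx' : x ∈ Submodule.span F
      { x : Module.End F U | x ∈ A ∧ ∃ γ : K, IsNilpotent (LinearMap.baseChange K x
        - γ • (1 : Module.End K (K ⊗[F] U))) }) :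
    x ∈ A ∧ ∃ γ : K, IsNilpotent (LinearMap.baseChange K x
        - γ • (1 : Module.End K (K ⊗[F] U))) := by
  have h1 : ∀ v, LinearMap.baseChange K (1 : Module.End F U) v = v := fun v => by
    rw [LinearMap.baseChange_one]; rfl
  have h0 : ∀ v, LinearMap.baseChange K (0 : Module.End F U) v = 0 := fun v => by
    rw [LinearMap.baseChange_zero]; rfl
  have hmul : ∀ (f g : Module.End F U) v, LinearMap.baseChange K (f * g) v =
      LinearMap.baseChange K f (LinearMap.baseChange K g v) := fun f g v => by
    rw [LinearMap.baseChange_mul]; rfl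
  have hadd : ∀ (f g : Module.End F U) v, LinearMap.baseChange K (f + g) v =
      LinearMap.baseChange K f v + LinearMap.baseChange K g v := fun f g v => by
    rw [LinearMap.baseChange_add]; rfl
  have hsmul : ∀ (c : F) (g : Module.End F U) v, LinearMap.baseChange K (c • g) v =
      algebraMap F K c • LinearMap.baseChange K g v := fun c g v => by
    rw [LinearMap.baseChange_smul, algebraMap_smul]; rfl
  exact qn_main' F K U (K ⊗[F] U) (fun g => LinearMap.baseChange K g)
    h1 h0 hmul hadd hsmul A hnil x hx'

/-- If a (not necessarily unital) subalgebra `A` of `End_F(U)`, `U`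
finite-dimensional, is a nilpotent Lie algebra under the commutator bracket and is
spanned as an `F`-vector space by its quasi-nilpotent elements, then every element of
`A` is quasi-nilpotent. -/
theorem quasiNilpotent_of_lieNilpotent_of_span (F : Type) [Field F]
    (U : Type) [AddCommGroup U] [Module F U] [FiniteDimensional F U]
    (A : NonUnitalSubalgebra F (Module.End F U))
    (hnil : ∃ m : ℕ, lcs F U (A : Set (Module.End F U)) m = ⊥)
    (hspan : (A : Set (Module.End F U)) ⊆ (Submodule.span F
      { x : Module.End F U | x ∈ A ∧ IsQuasiNilp F U x } : Submodule F _)) :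
    ∀ x ∈ A, IsQuasiNilp F U x := by
  intro x hx
  exact (qn_base F (AlgebraicClosure F) U A hnil x (hspan hx)).2

end
end

section
/- Let F be a field, U a finite-dimensional F-vector space, and A a subalgebra of End_F(U). Then A is quasi-nilpotent (every element of A is quasi-nilpotent) if and only if A with the commutator bracket [a,b] = ab − ba is a nilpotent Lie algebra and A is spanned as an F-vector space by quasi-nilpotent endomorphisms. -/
open scoped TensorProduct

noncomputable section
/-- Fitting idempotent of an element of a finite-dimensional algebra. -/
theorem fitting_idem {K R : Type*} [Field K] [Ring R] [Algebra K R] [FiniteDimensional K R]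
    (z : R) : ∃ (w : R) (k : ℕ), (z * w) * (z * w) = z * w ∧ z ^ k = (z * w) * z ^ k := by
  have hint : IsIntegral K z := IsIntegral.of_finite K z
  have hne : minpoly K z ≠ 0 := minpoly.ne_zero hint
  obtain ⟨g, hg, hnd⟩ :=
    Polynomial.exists_eq_pow_rootMultiplicity_mul_and_not_dvd (minpoly K z) hne 0
  generalize (minpoly K z).rootMultiplicity 0 = k at hg
  rw [Polynomial.C_0, sub_zero] at hg hnd
  have hcop : IsCoprime (Polynomial.X ^ (k + 1) : Polynomial K) g :=
    IsCoprime.pow_left ((Polynomial.irreducible_X.coprime_iff_not_dvd).2 hnd)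
  obtain ⟨a, b, hab⟩ := hcop
  have h0 : Polynomial.aeval z (Polynomial.X ^ k * g : Polynomial K) = 0 := by
    rw [← hg]; exact minpoly.aeval K z
  have key : ∀ p q r : Polynomial K, p - q = (Polynomial.X ^ k * g) * r →
      Polynomial.aeval z p = Polynomial.aeval z q := by
    intro p q r h
    rw [← sub_eq_zero, ← map_sub, h, map_mul, h0, zero_mul]
  refine ⟨Polynomial.aeval z (Polynomial.X ^ k * a), k, ?_, ?_⟩
  · have := key ((Polynomial.X * (Polynomial.X ^ k * a)) * (Polynomial.X * (Polynomial.X ^ k * a)))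
      (Polynomial.X * (Polynomial.X ^ k * a)) (- Polynomial.X * a * b)
      (by linear_combination (Polynomial.X ^ k * Polynomial.X * a) * hab)
    simpa only [map_mul, Polynomial.aeval_X] using this
  · have := key (Polynomial.X ^ k) ((Polynomial.X * (Polynomial.X ^ k * a)) * Polynomial.X ^ k) b
      (by linear_combination (- Polynomial.X ^ k) * hab)
    simpa only [map_mul, Polynomial.aeval_X, map_pow] using this

theorem nilp_mul {K R : Type*} [Field K] [Ring R] [Algebra K R] [FiniteDimensional K R]
    (hc : ∀ e : R, e * e = e → ∀ y, e * y = y * e) (x y : R) (hx : IsNilpotent x) :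
    IsNilpotent (x * y) := by
  obtain ⟨w, k, he, hk⟩ := fitting_idem (K := K) (x * y)
  obtain ⟨n, hn⟩ := hx
  have hcen := hc _ he
  generalize hE : x * y * w = e at *
  have hE' : x * (y * w) = e := by rw [← mul_assoc, hE]
  have h : ∀ n : ℕ, x ^ n * (y * w) ^ n * e = e := by
    intro n
    induction n with
    | zero => simp
    | succ n ih =>
      rw [pow_succ x, pow_succ' (y * w)]
      calc x ^ n * x * (y * w * (y * w) ^ n) * e
          = x ^ n * (x * (y * w)) * (y * w) ^ n * e := by simp only [mul_assoc]
        _ = e * (x ^ n * (y * w) ^ n * e) := by rw [hE', ← hcen (x ^ n)]; simp only [mul_assoc]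
        _ = e := by rw [ih, he]
  have he0 : e = 0 := by rw [← h n, hn]; simp
  exact ⟨k, by rw [hk, he0, zero_mul]⟩

theorem nilp_add {K R : Type*} [Field K] [Ring R] [Algebra K R] [FiniteDimensional K R]
    (hc : ∀ e : R, e * e = e → ∀ y, e * y = y * e) (x y : R) (hx : IsNilpotent x)
    (hy : IsNilpotent y) : IsNilpotent (x + y) := by
  obtain ⟨w, k, he, hk⟩ := fitting_idem (K := K) (x + y)
  have hcen := hc _ he
  generalize hE : (x + y) * w = e at *
  have hu := nilp_mul (K := K) hc x w hx
  have hv := nilp_mul (K := K) hc y w hy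
  have huv : x * w = e - y * w := by rw [← hE, add_mul]; abel
  have hcomm : Commute (x * w) (y * w) := by
    rw [huv]
    exact Commute.sub_left (hcen _) (Commute.refl _)
  obtain ⟨n, hn⟩ := hcomm.isNilpotent_add hu hv
  rw [← add_mul, hE] at hn
  have he0 : e = 0 := by
    have : IsIdempotentElem e := he
    have h1 := this.pow_succ_eq n
    rw [← h1, pow_succ, hn, zero_mul]
  exact ⟨k, by rw [hk, he0, zero_mul]⟩

attribute [local instance] LieRing.ofAssociativeRing

theorem ad_nilp_aux {F K E R : Type*} [Field F] [Field K] [Ring E] [Algebra F E] [Ring R]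
    [Algebra K R] (φ : E →+* R) (hinj : Function.Injective φ) (x : E) (γ : K)
    (hγ : IsNilpotent (φ x - γ • 1)) : IsNilpotent (LieAlgebra.ad F E x) := by
  obtain ⟨k, hk⟩ := LieAlgebra.ad_nilpotent_of_nilpotent (R := K) hγ
  refine ⟨k, ?_⟩
  have step : ∀ (j : ℕ) (y : E),
      φ ((LieAlgebra.ad F E x ^ j) y) = (LieAlgebra.ad K R (φ x - γ • 1) ^ j) (φ y) := by
    intro j
    induction j with
    | zero => intro y; simp
    | succ j ih =>
      intro y
      rw [pow_succ, pow_succ, Module.End.mul_apply, Module.End.mul_apply, ih]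
      congr 1
      rw [LieAlgebra.ad_apply, LieAlgebra.ad_apply, Ring.lie_def, Ring.lie_def]
      simp only [map_sub, map_mul, sub_mul, mul_sub, smul_mul_assoc, mul_smul_comm, one_mul, mul_one]
      abel
  ext1 y
  apply hinj
  have := step k y
  rw [hk] at this
  simpa using this

/-- Base change of endomorphisms to the algebraic closure, as a ring homomorphism. -/
def bcHom (F : Type) [Field F] (U : Type) [AddCommGroup U] [Module F U] :
    Module.End F U →+* Module.End (AlgebraicClosure F) (AlgebraicClosure F ⊗[F] U) :=
  (Module.End.baseChangeHom F (AlgebraicClosure F) U).toRingHom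

theorem isQuasiNilp_iff (F : Type) [Field F] (U : Type) [AddCommGroup U] [Module F U]
    (x : Module.End F U) : IsQuasiNilp F U x ↔
      ∃ γ : AlgebraicClosure F, IsNilpotent (bcHom F U x - γ • 1) := Iff.rfl

theorem ad_nilp_of_quasi (F : Type) [Field F]
    (U : Type) [AddCommGroup U] [Module F U] (x : Module.End F U)
    (hx : IsQuasiNilp F U x) : IsNilpotent (LieAlgebra.ad F (Module.End F U) x) := by
  obtain ⟨γ, hγ⟩ := (isQuasiNilp_iff F U x).1 hx
  exact ad_nilp_aux (bcHom F U)
    (LinearMap.baseChangeHom_injective (N := U) F U (AlgebraicClosure F)) x γ hγ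

theorem lcs_of_quasi (F : Type) [Field F]
    (U : Type) [AddCommGroup U] [Module F U] [FiniteDimensional F U]
    (A : NonUnitalSubalgebra F (Module.End F U)) (h : ∀ x ∈ A, IsQuasiNilp F U x) :
    ∃ m : ℕ, lcs F U (A : Set (Module.End F U)) m = ⊥ := by
  let L : LieSubalgebra F (Module.End F U) :=
    { A.toSubmodule with
      lie_mem' := fun {a b} ha hb => A.sub_mem (A.mul_mem ha hb) (A.mul_mem hb ha) }
  have hL : LieRing.IsNilpotent L := by
    rw [LieAlgebra.isNilpotent_iff_forall (R := F)]
    intro x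
    exact L.isNilpotent_ad_of_isNilpotent_ad (ad_nilp_of_quasi F U x (h x x.2))
  obtain ⟨m, hm⟩ := (LieModule.isNilpotent_iff F L L).1 hL
  have hspan : Submodule.span F (A : Set (Module.End F U)) = A.toSubmodule :=
    Submodule.span_eq A.toSubmodule
  have key : ∀ j, ∀ b ∈ lcs F U (A : Set (Module.End F U)) j,
      ∃ b' ∈ LieModule.lowerCentralSeries F L L j, (b' : Module.End F U) = b := by
    intro j
    induction j with
    | zero =>
      intro b hb
      rw [lcs, hspan] at hb
      exact ⟨⟨b, hb⟩, by simp, rfl⟩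
    | succ j ih =>
      intro b hb
      rw [lcs, hspan] at hb
      induction hb using Submodule.span_induction with
      | mem x hx =>
        obtain ⟨a, ha, c, hc, rfl⟩ := hx
        obtain ⟨c', hc', rfl⟩ := ih c hc
        refine ⟨⁅(⟨a, ha⟩ : L), c'⁆, ?_, rfl⟩
        rw [LieModule.lowerCentralSeries_succ]
        exact LieSubmodule.lie_mem_lie (LieSubmodule.mem_top _) hc'
      | zero => exact ⟨0, zero_mem _, rfl⟩
      | add x y _ _ hx hy =>
        obtain ⟨x', hx', rfl⟩ := hx
        obtain ⟨y', hy', rfl⟩ := hy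
        exact ⟨x' + y', add_mem hx' hy', rfl⟩
      | smul c x _ hx =>
        obtain ⟨x', hx', rfl⟩ := hx
        exact ⟨c • x', Submodule.smul_mem _ c hx', rfl⟩
  refine ⟨m, ?_⟩
  rw [eq_bot_iff]
  intro b hb
  obtain ⟨b', hb', rfl⟩ := key m b hb
  rw [hm] at hb'
  have : b' = 0 := by simpa using hb'
  simp [this]

/-- The unital algebra over the algebraic closure generated by `A`. -/
def bcAlg (F : Type) [Field F] (U : Type) [AddCommGroup U] [Module F U]
    {K R : Type*} [Field K] [Ring R] [Algebra K R] (φ : Module.End F U →+* R)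
    (A : NonUnitalSubalgebra F (Module.End F U)) :
    Subalgebra K
      (R) :=
  Algebra.adjoin K
    (φ '' (A : Set (Module.End F U)))

theorem bcAlg_span (F : Type) [Field F] (U : Type) [AddCommGroup U] [Module F U]
    {K R : Type*} [Field K] [Ring R] [Algebra K R] (φ : Module.End F U →+* R)
    (A : NonUnitalSubalgebra F (Module.End F U)) (r) (hr : r ∈ bcAlg F U (K := K) φ A) :
    r ∈ Submodule.span K (insert 1
      (φ '' (A : Set (Module.End F U)))) := by
  have h : r ∈ Subalgebra.toSubmodule (bcAlg F U (K := K) φ A) := hr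
  rw [bcAlg, Algebra.adjoin_eq_span] at h
  refine Submodule.span_mono ?_ h
  intro s hs
  induction hs using Submonoid.closure_induction with
  | mem x hx => exact Or.inr hx
  | one => exact Or.inl rfl
  | mul x y _ _ hx hy =>
    rcases hx with rfl | ⟨a, ha, rfl⟩
    · simpa using hy
    · rcases hy with rfl | ⟨b, hb, rfl⟩
      · right; exact ⟨a, ha, by simp⟩
      · right; exact ⟨a * b, A.mul_mem ha hb, by simp ⟩

theorem bcAlg_idem (F : Type) [Field F] (U : Type) [AddCommGroup U] [Module F U]
    {K R : Type*} [Field K] [Ring R] [Algebra K R] (φ : Module.End F U →+* R)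
    (A : NonUnitalSubalgebra F (Module.End F U)) (m : ℕ)
    (hm : lcs F U (A : Set (Module.End F U)) m = ⊥) (e : bcAlg F U (K := K) φ A) (he : e * e = e)
    (y : bcAlg F U (K := K) φ A) : e * y = y * e := by
  let C : ℕ → Submodule K
      (R) := fun j =>
    Submodule.span _ (φ ''
      (lcs F U (A : Set (Module.End F U)) j : Set (Module.End F U)))
  have gen : ∀ (D : Submodule K
      (R)) (S T : Set _),
      (∀ a ∈ S, ∀ b ∈ T, a * b - b * a ∈ D) →
      ∀ a ∈ Submodule.span K S, ∀ b ∈ Submodule.span K T,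
        a * b - b * a ∈ D := by
    intro D S T h a ha b hb
    induction ha using Submodule.span_induction with
    | mem a ha =>
      induction hb using Submodule.span_induction with
      | mem b hb => exact h a ha b hb
      | zero => simp
      | add x y _ _ hx hy =>
        have : a * (x + y) - (x + y) * a = (a * x - x * a) + (a * y - y * a) := by noncomm_ring
        rw [this]; exact add_mem hx hy
      | smul c x _ hx =>
        rw [mul_smul_comm, smul_mul_assoc, ← smul_sub]; exact D.smul_mem c hx
    | zero => simp
    | add x y _ _ hx hy =>
      have : (x + y) * b - b * (x + y) = (x * b - b * x) + (y * b - b * y) := by noncomm_ring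
      rw [this]; exact add_mem hx hy
    | smul c x _ hx =>
      rw [mul_smul_comm, smul_mul_assoc, ← smul_sub]; exact D.smul_mem c hx
  have h1 : ∀ j, ∀ r ∈ bcAlg F U (K := K) φ A, ∀ b ∈ C j, r * b - b * r ∈ C (j + 1) := by
    intro j r hr b hb
    refine gen (C (j + 1)) _ _ ?_ r (bcAlg_span F U φ A r hr) b hb
    rintro a (rfl | ⟨a, ha, rfl⟩) b ⟨b, hb, rfl⟩
    · simp
    · refine Submodule.subset_span ⟨a * b - b * a, ?_, by
        simp ⟩
      exact Submodule.subset_span ⟨a, Submodule.subset_span ha, b, hb, rfl⟩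
  have h0 : ∀ r ∈ bcAlg F U (K := K) φ A, ∀ b ∈ bcAlg F U (K := K) φ A, r * b - b * r ∈ C 0 := by
    intro r hr b hb
    refine gen (C 0) _ _ ?_ r (bcAlg_span F U φ A r hr) b (bcAlg_span F U φ A b hb)
    rintro a (rfl | ⟨a, ha, rfl⟩) b (rfl | ⟨b, hb, rfl⟩)
    · simp
    · simp
    · simp
    · refine Submodule.subset_span ⟨a * b - b * a, ?_, by
        simp ⟩
      exact Submodule.subset_span (A.sub_mem (A.mul_mem ha hb) (A.mul_mem hb ha))
  obtain ⟨e, heA⟩ := e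
  obtain ⟨y, hyA⟩ := y
  have he' : e * e = e := congrArg Subtype.val he
  apply Subtype.ext
  change e * y = y * e
  have hdec : ∀ j, C (j + 1) ≤ C j := by
    intro j
    refine Submodule.span_mono (Set.image_mono ?_)
    change lcs F U (A : Set (Module.End F U)) (j + 1) ≤ lcs F U (A : Set (Module.End F U)) j
    have hspan : Submodule.span F (A : Set (Module.End F U)) = A.toSubmodule :=
      Submodule.span_eq A.toSubmodule
    induction j with
    | zero =>
      rw [lcs, lcs, Submodule.span_le]
      rintro _ ⟨a, ha, b, hb, rfl⟩
      rw [lcs] at hb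
      rw [hspan] at *
      exact A.sub_mem (A.mul_mem ha hb) (A.mul_mem hb ha)
    | succ j ih =>
      rw [lcs, Submodule.span_le]
      rintro _ ⟨a, ha, b, hb, rfl⟩
      exact Submodule.subset_span ⟨a, ha, b, ih hb, rfl⟩
  have hd : ∀ j, e * y - y * e ∈ C j := by
    intro j
    induction j with
    | zero => exact h0 e heA y hyA
    | succ j ih =>
      have h2 := hdec _ (h1 _ e heA _ (h1 _ e heA _ ih))
      have : e * (e * (e * y - y * e) - (e * y - y * e) * e)
          - (e * (e * y - y * e) - (e * y - y * e) * e) * e = e * y - y * e := by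
        have e1 : ∀ t, e * (e * t) = e * t := fun t => by rw [← mul_assoc, he']
        simp only [mul_sub, sub_mul, mul_assoc, he', e1]
        abel
      rwa [this] at h2
  have := hd m
  simp only [C, hm] at this
  have h3 : e * y - y * e = 0 := by simpa using this
  exact sub_eq_zero.1 h3

theorem quasi_add (F : Type) [Field F] (U : Type) [AddCommGroup U] [Module F U]
    {K R : Type*} [Field K] [Ring R] [Algebra K R] [FiniteDimensional K R]
    (φ : Module.End F U →+* R)
    (A : NonUnitalSubalgebra F (Module.End F U)) (m : ℕ)
    (hm : lcs F U (A : Set (Module.End F U)) m = ⊥) (x y : Module.End F U) (hxA : x ∈ A)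
    (hyA : y ∈ A) (γ δ : K) (hx : IsNilpotent (φ x - γ • 1)) (hy : IsNilpotent (φ y - δ • 1)) :
    IsNilpotent (φ (x + y) - (γ + δ) • 1) := by
  have hmem : ∀ (x : Module.End F U) (γ : K), x ∈ A →
      φ x - γ • 1 ∈ bcAlg F U (K := K) φ A := fun x γ hx =>
    sub_mem (Algebra.subset_adjoin ⟨x, hx, rfl⟩) (Subalgebra.smul_mem _ (one_mem _) γ)
  obtain ⟨n, hn⟩ := hx
  obtain ⟨k, hk⟩ := hy
  have := nilp_add (K := K) (bcAlg_idem F U (K := K) φ A m hm) ⟨_, hmem x γ hxA⟩ ⟨_, hmem y δ hyA⟩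
    ⟨n, Subtype.ext hn⟩ ⟨k, Subtype.ext hk⟩
  have h2 := this.map (bcAlg F U (K := K) φ A).val
  convert h2 using 1
  simp only [map_add, Subalgebra.coe_val, add_smul]
  abel

theorem quasi_zero {E K R : Type*} [Field K] [Ring E] [Ring R] [Algebra K R] (φ : E →+* R) :
    IsNilpotent (φ 0 - (0 : K) • 1) := by simp

theorem quasi_smul {K R : Type*} [Field K] [Ring R] [Algebra K R] (c γ : K) (x y : R)
    (h : IsNilpotent (x - γ • 1)) (hy : y = c • x) : IsNilpotent (y - (c * γ) • 1) := by
  subst hy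
  have h2 := h.smul c
  rwa [smul_sub, ← mul_smul] at h2

/-- A (not necessarily unital) subalgebra `A` of `End_F(U)`, `U`
finite-dimensional, is quasi-nilpotent (every element is quasi-nilpotent) if and only if
`A` is a nilpotent Lie algebra under the commutator bracket and `A` is spanned as an
`F`-vector space by its quasi-nilpotent elements. -/
theorem quasiNilpotent_iff_lieNilpotent_and_span (F : Type) [Field F]
    (U : Type) [AddCommGroup U] [Module F U] [FiniteDimensional F U]
    (A : NonUnitalSubalgebra F (Module.End F U)) :
    (∀ x ∈ A, IsQuasiNilp F U x) ↔
      (∃ m : ℕ, lcs F U (A : Set (Module.End F U)) m = ⊥) ∧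
      (A : Set (Module.End F U)) ⊆ (Submodule.span F
        { x : Module.End F U | x ∈ A ∧ IsQuasiNilp F U x } : Submodule F _) := by
  constructor
  · intro h
    exact ⟨lcs_of_quasi F U A h, fun x hx => Submodule.subset_span ⟨hx, h x hx⟩⟩
  · rintro ⟨⟨m, hm⟩, hs⟩ x hx
    suffices H : x ∈ A ∧ IsQuasiNilp F U x from H.2
    have hx' := hs hx
    clear hx
    induction hx' using Submodule.span_induction with
    | mem x hx => exact hx
    | zero => exact ⟨A.zero_mem, (isQuasiNilp_iff F U _).2 ⟨0, quasi_zero (bcHom F U)⟩⟩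
    | add x y _ _ hx hy =>
      obtain ⟨γ, hn⟩ := (isQuasiNilp_iff F U x).1 hx.2
      obtain ⟨δ, hk⟩ := (isQuasiNilp_iff F U y).1 hy.2
      exact ⟨A.add_mem hx.1 hy.1, (isQuasiNilp_iff F U _).2
        ⟨γ + δ, quasi_add F U (bcHom F U) A m hm x y hx.1 hy.1 γ δ hn hk⟩⟩
    | smul c x _ hx =>
      obtain ⟨γ, hn⟩ := (isQuasiNilp_iff F U x).1 hx.2
      refine ⟨A.toSubmodule.smul_mem c hx.1, (isQuasiNilp_iff F U _).2
        ⟨algebraMap F _ c * γ, quasi_smul _ γ (bcHom F U x) _ hn ?_⟩⟩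
      rw [algebraMap_smul]
      exact LinearMap.baseChange_smul c x

end
end
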